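/- Let n ≥ 3, let q be a prime power, and let c be a code word of C_{n-1}(n,q) with (3q−6)θ_{n-2}+3 ≤ wt(c) ≤ B_{n,q}. Then no 3-secant to supp(c) is contained in θ_{n-2} hyperplanes of PG(n,q) that are all of the same type T ∈ {T^odd, T^△}. -/

import Mathlib

open scoped Classical

noncomputable section

namespace PGCode

open Projectivization

/-- The points of `PG(n, q)`, where the field `F` has order `q`. -/
abbrev Pt (F : Type) [Field F] (n : ℕ) := Projectivization F (Fin (n + 1) → F)

variable {F : Type} [Field F]

/-- A point of `PG(n,q)` lies in the projective subspace determined by a linear subspace `W`. -/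
def ptIn {n : ℕ} (P : Pt F n) (W : Submodule F (Fin (n + 1) → F)) : Prop :=
  Projectivization.submodule P ≤ W

/-- The set of points of the projective subspace determined by a linear subspace `W`. -/
def ptsIn {n : ℕ} (W : Submodule F (Fin (n + 1) → F)) : Set (Pt F n) :=
  {P | ptIn P W}

/-- The incidence vector (over `F_p = ZMod p`) of the projective subspace determined by `W`. -/
def incVec (p : ℕ) {n : ℕ} (W : Submodule F (Fin (n + 1) → F)) : Pt F n → ZMod p :=
  fun P => if ptIn P W then (1 : ZMod p) else 0

/-- The code `C_{n-1}(n,q)`: the `F_p`-span of the incidence vectors of all hyperplanes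
(projective dimension `n-1`, i.e. linear dimension `n`). -/
def code (F : Type) [Field F] (p n : ℕ) : Submodule (ZMod p) (Pt F n → ZMod p) :=
  Submodule.span (ZMod p)
    {v | ∃ W : Submodule F (Fin (n + 1) → F), Module.finrank F W = n ∧ v = incVec p W}

/-- The support of a word. -/
def supp {p n : ℕ} (v : Pt F n → ZMod p) : Set (Pt F n) := {P | v P ≠ 0}

/-- The weight of a word. -/
def wt {p n : ℕ} (v : Pt F n → ZMod p) : ℕ := (supp v).ncard

/-- The weight of the restriction of a word to the subspace determined by `W`. -/
def wtRes {p n : ℕ} (c : Pt F n → ZMod p) (W : Submodule F (Fin (n + 1) → F)) : ℕ :=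
  (ptsIn W ∩ supp c).ncard

/-- `θ_m = (q^(m+1) - 1)/(q - 1)`, with `θ_m = 0` for `m < 0`. -/
def theta (q : ℕ) (m : ℤ) : ℕ :=
  if m < 0 then 0 else ∑ i ∈ Finset.range (m.toNat + 1), q ^ i

/-- The bound `B_{n,q}` from the paper. -/
def B (n q : ℕ) : ℝ :=
  if q < 7 ∨ q = 8 ∨ q = 9 ∨ q = 16 ∨ q = 25 ∨ q = 27 ∨ q = 49 then
    2 * (q : ℝ) ^ (n - 1)
  else if q = 7 ∨ q = 11 ∨ q = 13 ∨ q = 17 then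
    (3 * q - Real.sqrt (6 * q) - 1 / 2) * (q : ℝ) ^ (n - 2)
  else if q = 19 ∨ q = 121 then
    (3 * q - Real.sqrt (6 * q) + 9 / 2) * (q : ℝ) ^ (n - 2)
  else if q = 29 ∨ q = 31 ∨ q = 32 then
    (4 * q - 4 * Real.sqrt q - 25 / 2) * (q : ℝ) ^ (n - 2)
  else
    (4 * q - Real.sqrt (8 * q) - 33 / 2) * (q : ℝ) ^ (n - 2)

/-- A line of `PG(n,q)`: a linear subspace of dimension `2`. -/
def IsLine {n : ℕ} (l : Submodule F (Fin (n + 1) → F)) : Prop := Module.finrank F l = 2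

/-- A plane of `PG(n,q)`: a linear subspace of dimension `3`. -/
def IsPlane {n : ℕ} (W : Submodule F (Fin (n + 1) → F)) : Prop := Module.finrank F W = 3

/-- The line `l` is an `α`-secant to `supp c`. -/
def secant {p n : ℕ} (c : Pt F n → ZMod p) (l : Submodule F (Fin (n + 1) → F)) (α : ℕ) : Prop :=
  IsLine l ∧ (ptsIn l ∩ supp c).ncard = α

/-- The restriction of `c` to the plane `W` is a linear combination of at most two lines of `W`. -/
def TwoLineComb (p : ℕ) {n : ℕ} (c : Pt F n → ZMod p) (W : Submodule F (Fin (n + 1) → F)) :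
    Prop :=
  ∃ l₁ l₂ : Submodule F (Fin (n + 1) → F), IsLine l₁ ∧ IsLine l₂ ∧ l₁ ≤ W ∧ l₂ ≤ W ∧
    ∃ a b : ZMod p, ∀ P : Pt F n, ptIn P W → c P = a * incVec p l₁ P + b * incVec p l₂ P

/-- Type `T^△`: the restriction of `c` to the plane `W` is a linear combination (with nonzero
coefficients) of three nonconcurrent lines of `W`. -/
def TypeTri (p : ℕ) {n : ℕ} (c : Pt F n → ZMod p) (W : Submodule F (Fin (n + 1) → F)) : Prop :=
  ∃ l₁ l₂ l₃ : Submodule F (Fin (n + 1) → F),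
    IsLine l₁ ∧ IsLine l₂ ∧ IsLine l₃ ∧ l₁ ≤ W ∧ l₂ ≤ W ∧ l₃ ≤ W ∧
    l₁ ≠ l₂ ∧ l₁ ≠ l₃ ∧ l₂ ≠ l₃ ∧
    (¬ ∃ P : Pt F n, ptIn P l₁ ∧ ptIn P l₂ ∧ ptIn P l₃) ∧
    ∃ a₁ a₂ a₃ : ZMod p, a₁ ≠ 0 ∧ a₂ ≠ 0 ∧ a₃ ≠ 0 ∧
      ∀ P : Pt F n, ptIn P W →
        c P = a₁ * incVec p l₁ P + a₂ * incVec p l₂ P + a₃ * incVec p l₃ P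

/-- Type `T^★`: the restriction of `c` to the plane `W` is a linear combination (with nonzero
coefficients) of three distinct concurrent lines of `W`. -/
def TypeStar (p : ℕ) {n : ℕ} (c : Pt F n → ZMod p) (W : Submodule F (Fin (n + 1) → F)) : Prop :=
  ∃ l₁ l₂ l₃ : Submodule F (Fin (n + 1) → F),
    IsLine l₁ ∧ IsLine l₂ ∧ IsLine l₃ ∧ l₁ ≤ W ∧ l₂ ≤ W ∧ l₃ ≤ W ∧
    l₁ ≠ l₂ ∧ l₁ ≠ l₃ ∧ l₂ ≠ l₃ ∧
    (∃ P : Pt F n, ptIn P l₁ ∧ ptIn P l₂ ∧ ptIn P l₃) ∧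
    ∃ a₁ a₂ a₃ : ZMod p, a₁ ≠ 0 ∧ a₂ ≠ 0 ∧ a₃ ≠ 0 ∧
      ∀ P : Pt F n, ptIn P W →
        c P = a₁ * incVec p l₁ P + a₂ * incVec p l₂ P + a₃ * incVec p l₃ P

/-- The base code word `c₀` of the `T^odd` construction on `PG(2,p)`:
`c₀(0,1,a) = a`, `c₀(1,0,b) = b`, `c₀(1,1,c) = -c`, and `c₀ = 0` elsewhere. -/
def oddBase (p : ℕ) [Fact p.Prime] : Pt (ZMod p) 2 → ZMod p := fun P =>
  if P.rep 0 = 0 ∧ P.rep 1 ≠ 0 then P.rep 2 / P.rep 1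
  else if P.rep 1 = 0 ∧ P.rep 0 ≠ 0 then P.rep 2 / P.rep 0
  else if P.rep 0 = P.rep 1 ∧ P.rep 0 ≠ 0 then -(P.rep 2 / P.rep 0)
  else 0

/-- The line `m : X₀ = 0` of `PG(2,p)`. -/
def lineM1 (p : ℕ) [Fact p.Prime] : Submodule (ZMod p) (Fin 3 → ZMod p) :=
  LinearMap.ker (LinearMap.proj 0 : (Fin 3 → ZMod p) →ₗ[ZMod p] ZMod p)

/-- The line `m' : X₁ = 0` of `PG(2,p)`. -/
def lineM2 (p : ℕ) [Fact p.Prime] : Submodule (ZMod p) (Fin 3 → ZMod p) :=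
  LinearMap.ker (LinearMap.proj 1 : (Fin 3 → ZMod p) →ₗ[ZMod p] ZMod p)

/-- The line `m'' : X₀ = X₁` of `PG(2,p)`. -/
def lineM3 (p : ℕ) [Fact p.Prime] : Submodule (ZMod p) (Fin 3 → ZMod p) :=
  LinearMap.ker ((LinearMap.proj 0 : (Fin 3 → ZMod p) →ₗ[ZMod p] ZMod p) - LinearMap.proj 1)

/-- The code word `d = (γ c₀ + λ m + λ' m' + λ'' m'')^π` of the `T^odd` construction, where the
collineation `π` of `PG(2,p)` is the inverse of the homography induced by the linear
equivalence `g`. -/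
def oddWord (p : ℕ) [Fact p.Prime] (g : (Fin 3 → ZMod p) ≃ₗ[ZMod p] (Fin 3 → ZMod p))
    (γ lam lam' lam'' : ZMod p) : Pt (ZMod p) 2 → ZMod p := fun P =>
  γ * oddBase p (Projectivization.map g.toLinearMap g.injective P) +
    lam * incVec p (lineM1 p) (Projectivization.map g.toLinearMap g.injective P) +
    lam' * incVec p (lineM2 p) (Projectivization.map g.toLinearMap g.injective P) +
    lam'' * incVec p (lineM3 p) (Projectivization.map g.toLinearMap g.injective P)

/-- The semilinear embedding of `PG(2,p)` onto the plane of `PG(n,q)` spanned by the linearly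
independent vectors `b 0, b 1, b 2`, relative to the field embedding `σ : F_p → F`. -/
def planeEmbed {n : ℕ} {p : ℕ} [Fact p.Prime] (σ : ZMod p →+* F)
    (b : Fin 3 → (Fin (n + 1) → F)) (hb : LinearIndependent F b) :
    Pt (ZMod p) 2 → Pt F n := fun P =>
  Projectivization.mk F (∑ i, σ (P.rep i) • b i) (by
    intro hzero
    have h0 : ∀ i ∈ Finset.univ, σ (P.rep i) = 0 :=
      linearIndependent_iff'.mp hb Finset.univ (fun i => σ (P.rep i)) hzero
    have h1 : P.rep = 0 := funext fun i => σ.injective (by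
      simp only [Pi.zero_apply, map_zero]; exact h0 i (Finset.mem_univ i))
    exact P.rep_nonzero h1)

/-- Type `T^odd`: this requires `q = p` to be prime (`|F| = p`), and `c` restricted to the plane
`W` (spanned by the frame `b`) must coincide, via a semilinear identification of `W` with
`PG(2,p)`, with a code word `d` of the `T^odd` construction. -/
def TypeOdd (p : ℕ) [Fact p.Prime] [Fintype F] {n : ℕ} (c : Pt F n → ZMod p)
    (W : Submodule F (Fin (n + 1) → F)) : Prop :=
  Fintype.card F = p ∧
  ∃ (σ : ZMod p →+* F) (b : Fin 3 → (Fin (n + 1) → F)) (hb : LinearIndependent F b),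
    Submodule.span F (Set.range b) = W ∧
    ∃ (g : (Fin 3 → ZMod p) ≃ₗ[ZMod p] (Fin 3 → ZMod p)) (γ lam lam' lam'' : ZMod p), γ ≠ 0 ∧
      ∀ Q : Pt (ZMod p) 2, c (planeEmbed σ b hb Q) = oddWord p g γ lam lam' lam'' Q

/-- The list of plane types `T_0, T_{q+1}, T_{2q}, T_{2q+1}, T^odd, T^△, T^★`. -/
inductive PlaneT : Type where
  | T0 | Tq1 | T2q | T2q1 | Todd | Ttri | Tstar
deriving DecidableEq

/-- The restriction of `c` to the plane `W` is a code word of the given type. -/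
def PlaneIsType (p q : ℕ) [Fact p.Prime] [Fintype F] {n : ℕ} (c : Pt F n → ZMod p)
    (W : Submodule F (Fin (n + 1) → F)) : PlaneT → Prop
  | .T0 => TwoLineComb p c W ∧ wtRes c W = 0
  | .Tq1 => TwoLineComb p c W ∧ wtRes c W = q + 1
  | .T2q => TwoLineComb p c W ∧ wtRes c W = 2 * q
  | .T2q1 => TwoLineComb p c W ∧ wtRes c W = 2 * q + 1
  | .Todd => TypeOdd p c W
  | .Ttri => TypeTri p c W
  | .Tstar => TypeStar p c W

/-- The plane `W` is of type `𝒯`. -/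
def TypeT (p q : ℕ) [Fact p.Prime] [Fintype F] {n : ℕ} (c : Pt F n → ZMod p)
    (W : Submodule F (Fin (n + 1) → F)) : Prop :=
  IsPlane W ∧ ∃ t : PlaneT, PlaneIsType p q c W t

/-- The plane `W` is of type `𝒪`. -/
def TypeO (p q : ℕ) [Fact p.Prime] [Fintype F] {n : ℕ} (c : Pt F n → ZMod p)
    (W : Submodule F (Fin (n + 1) → F)) : Prop :=
  IsPlane W ∧ ¬ TypeT p q c W

/-- The restriction of `c` to the `k`-space `Sp` (linear dimension `k+1`) is of type `t`:
there is a `(k-3)`-space `κ ⊆ Sp` on which `c` is a scalar multiple of the all-one function,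
a plane `π ⊆ Sp` of type `t` disjoint from `κ`, and `c P = c (⟨κ, P⟩ ∩ π)` for every point
`P` of `Sp` outside `κ`. -/
def SpaceIsType (p q : ℕ) [Fact p.Prime] [Fintype F] {n : ℕ} (c : Pt F n → ZMod p)
    (Sp : Submodule F (Fin (n + 1) → F)) (k : ℕ) (t : PlaneT) : Prop :=
  Module.finrank F Sp = k + 1 ∧
  ∃ κ : Submodule F (Fin (n + 1) → F), Module.finrank F κ = k - 2 ∧ κ ≤ Sp ∧
    (∃ a : ZMod p, ∀ P : Pt F n, ptIn P κ → c P = a) ∧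
    ∃ π : Submodule F (Fin (n + 1) → F), IsPlane π ∧ π ≤ Sp ∧ π ⊓ κ = ⊥ ∧
      PlaneIsType p q c π t ∧
      ∀ P : Pt F n, ptIn P Sp → ¬ ptIn P κ →
        ∃ Q : Pt F n, ptIn Q π ∧
          Projectivization.submodule Q ≤ κ ⊔ Projectivization.submodule P ∧ c P = c Q

section HyperplaneFunctions

variable {V : Type*} [AddCommGroup V] [Module F V]

/-- The span of the indicator functions of the kernels of linear functionals on `V`. -/
def hypFun (F V : Type*) [Field F] [AddCommGroup V] [Module F V] : Submodule F (V → F) :=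
  Submodule.span F (Set.range fun (a : V →ₗ[F] F) (v : V) => if a v = 0 then (1 : F) else 0)

theorem hypFun_smul {C : V → F} (hC : C ∈ hypFun F V) {x : F} (hx : x ≠ 0) (v : V) :
    C (x • v) = C v := by
  induction hC using Submodule.span_induction with
  | mem f hf => obtain ⟨a, rfl⟩ := hf; simp [hx]
  | zero => rfl
  | add f g _ _ hf hg => simp [hf, hg]
  | smul r f _ hf => simp [hf]

variable [Fintype F]

theorem sum_mul_indicator (g : F → F) (a : V →ₗ[F] F) (e w : V) :
    ∑ x, g x * (if a (x • e + w) = 0 then (1 : F) else 0) =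
      if a e = 0 then (if a w = 0 then ∑ x, g x else 0) else g (-(a w) / a e) := by
  by_cases he : a e = 0
  · by_cases hw : a w = 0 <;> simp [he, hw]
  · have : ∀ x : F, a (x • e + w) = 0 ↔ x = -(a w) / a e := by
      intro x
      rw [eq_div_iff he, map_add, map_smul, smul_eq_mul, add_eq_zero_iff_eq_neg]
    simp only [this, he, if_false, mul_ite, mul_one, mul_zero, Finset.sum_ite_eq', Finset.mem_univ,
      if_true]

theorem sum_pow_eq_zero {j : ℕ} (hj : j + 1 < Fintype.card F) : ∑ x : F, x ^ j = 0 :=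
  FiniteField.sum_pow_lt_card_sub_one F j (by omega)

theorem hypFun_sum_line {C : V → F} (hC : C ∈ hypFun F V) (e w : V) :
    ∑ x : F, C (x • e + w) = C 0 - C e := by
  induction hC using Submodule.span_induction with
  | mem f hf =>
    obtain ⟨a, rfl⟩ := hf
    have := sum_mul_indicator (fun _ => (1 : F)) a e w
    simp only [one_mul] at this
    rw [this]
    by_cases he : a e = 0 <;> simp [he]
  | zero => simp
  | add f g _ _ hf hg => simp only [Pi.add_apply, Finset.sum_add_distrib, hf, hg]; ring
  | smul r f _ hf => simp only [Pi.smul_apply, smul_eq_mul, ← Finset.mul_sum, hf]; ring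

/-- The first moments of a hyperplane function along a direction form a linear functional. -/
theorem hypFun_moment_one (hF : 2 < Fintype.card F) {C : V → F} (hC : C ∈ hypFun F V) (e : V) :
    ∃ φ : V →ₗ[F] F, ∀ w, ∑ x : F, x * C (x • e + w) = φ w := by
  have h1 : ∑ x : F, x = 0 := by simpa using sum_pow_eq_zero (F := F) (j := 1) (by omega)
  induction hC using Submodule.span_induction with
  | mem f hf =>
    obtain ⟨a, rfl⟩ := hf
    refine ⟨(-(a e)⁻¹) • a, fun w => ?_⟩
    rw [sum_mul_indicator (fun x => x)]
    by_cases he : a e = 0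
    · simp [he, h1]
    · simp [he]; field_simp
  | zero => exact ⟨0, fun w => by simp⟩
  | add f g _ _ hf hg =>
    obtain ⟨φ, hφ⟩ := hf
    obtain ⟨ψ, hψ⟩ := hg
    exact ⟨φ + ψ, fun w => by
      simp only [Pi.add_apply, mul_add, Finset.sum_add_distrib, hφ, hψ, LinearMap.add_apply]⟩
  | smul r f _ hf =>
    obtain ⟨φ, hφ⟩ := hf
    exact ⟨r • φ, fun w => by
      simp only [Pi.smul_apply, smul_eq_mul, mul_left_comm _ r, ← Finset.mul_sum, hφ,
        LinearMap.smul_apply]⟩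

/-- The second moments of a hyperplane function along a direction form a quadratic form. -/
theorem hypFun_moment_two (hF : 3 < Fintype.card F) {C : V → F} (hC : C ∈ hypFun F V) (e : V) :
    ∃ β : V →ₗ[F] V →ₗ[F] F, (∀ v w, β v w = β w v) ∧
      ∀ w, ∑ x : F, x ^ 2 * C (x • e + w) = β w w := by
  have h1 : ∑ x : F, x ^ 2 = 0 := sum_pow_eq_zero (by omega)
  induction hC using Submodule.span_induction with
  | mem f hf =>
    obtain ⟨a, rfl⟩ := hf
    refine ⟨((a e)⁻¹ ^ 2) • a.smulRight a, fun v w => by simp [mul_comm], fun w => ?_⟩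
    rw [sum_mul_indicator (fun x => x ^ 2)]
    by_cases he : a e = 0
    · simp [he, h1]
    · simp [he]; field_simp
  | zero => exact ⟨0, by simp, fun w => by simp⟩
  | add f g _ _ hf hg =>
    obtain ⟨φ, hφs, hφ⟩ := hf
    obtain ⟨ψ, hψs, hψ⟩ := hg
    exact ⟨φ + ψ, fun v w => by simp [hφs v w, hψs v w], fun w => by
      simp only [Pi.add_apply, mul_add, Finset.sum_add_distrib, hφ, hψ, LinearMap.add_apply]⟩
  | smul r f _ hf =>
    obtain ⟨φ, hφs, hφ⟩ := hf
    exact ⟨r • φ, fun v w => by simp [hφs v w], fun w => by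
      simp only [Pi.smul_apply, smul_eq_mul, mul_left_comm _ r, ← Finset.mul_sum, hφ,
        LinearMap.smul_apply]⟩

/-- A difference of third moments of a hyperplane function that is an affine function. -/
theorem hypFun_moment_three (hF : 4 < Fintype.card F) {C : V → F} (hC : C ∈ hypFun F V)
    (e e' : V) (ω : F) :
    ∃ (φ : V →ₗ[F] F) (k : F), ∀ u,
      ∑ x : F, x ^ 3 * C (x • e + (ω • e' + u)) - ω * ∑ x : F, x ^ 3 * C (x • e + (e' + u)) -
        (1 - ω) * ∑ x : F, x ^ 3 * C (x • e + u) = φ u + k := by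
  have h1 : ∑ x : F, x ^ 3 = 0 := sum_pow_eq_zero (by omega)
  induction hC using Submodule.span_induction with
  | mem f hf =>
    obtain ⟨a, rfl⟩ := hf
    simp only [sum_mul_indicator (fun x => x ^ 3)]
    by_cases he : a e = 0
    · exact ⟨0, 0, fun u => by simp [he, h1]⟩
    · refine ⟨(-(a e)⁻¹ ^ 3 * (3 * a e' ^ 2 * (ω ^ 2 - ω))) • a,
        -(a e)⁻¹ ^ 3 * (a e' ^ 3 * (ω ^ 3 - ω)), fun u => ?_⟩
      simp only [he, if_false, map_add, map_smul, smul_eq_mul, LinearMap.smul_apply]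
      field_simp
      ring
  | zero => exact ⟨0, 0, fun w => by simp⟩
  | add f g _ _ hf hg =>
    obtain ⟨φ, k, hφ⟩ := hf
    obtain ⟨ψ, m, hψ⟩ := hg
    refine ⟨φ + ψ, k + m, fun u => ?_⟩
    simp only [Pi.add_apply, mul_add, Finset.sum_add_distrib, LinearMap.add_apply]
    linear_combination hφ u + hψ u
  | smul r f _ hf =>
    obtain ⟨φ, k, hφ⟩ := hf
    refine ⟨r • φ, r * k, fun u => ?_⟩
    simp only [Pi.smul_apply, smul_eq_mul, mul_left_comm _ r, ← Finset.mul_sum,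
      LinearMap.smul_apply]
    linear_combination r * hφ u

theorem indicator_eq_one_sub_pow (x : F) :
    (if x = 0 then (1 : F) else 0) = 1 - x ^ (Fintype.card F - 1) := by
  have := Fintype.one_lt_card (α := F)
  by_cases hx : x = 0
  · simp [hx, zero_pow (show Fintype.card F - 1 ≠ 0 by omega)]
  · simp [hx, FiniteField.pow_card_sub_one_eq_one x hx]

theorem hypFun_affine (hF : Fintype.card F = 2) {C : V → F} (hC : C ∈ hypFun F V) :
    ∃ φ : V →ₗ[F] F, ∀ v, C v = C 0 - φ v := by
  induction hC using Submodule.span_induction with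
  | mem f hf =>
    obtain ⟨a, rfl⟩ := hf
    refine ⟨a, fun v => ?_⟩
    simp [indicator_eq_one_sub_pow, hF]
  | zero => exact ⟨0, by simp⟩
  | add f g _ _ hf hg =>
    obtain ⟨φ, hφ⟩ := hf
    obtain ⟨ψ, hψ⟩ := hg
    refine ⟨φ + ψ, fun v => ?_⟩
    simp only [Pi.add_apply, LinearMap.add_apply]
    linear_combination hφ v + hψ v
  | smul r f _ hf =>
    obtain ⟨φ, hφ⟩ := hf
    refine ⟨r • φ, fun v => ?_⟩
    simp only [Pi.smul_apply, LinearMap.smul_apply, smul_eq_mul]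
    linear_combination r * hφ v

theorem hypFun_quadratic (hF : Fintype.card F = 3) {C : V → F} (hC : C ∈ hypFun F V) :
    ∃ β : V →ₗ[F] V →ₗ[F] F, (∀ v w, β v w = β w v) ∧ ∀ v, C v = C 0 - β v v := by
  induction hC using Submodule.span_induction with
  | mem f hf =>
    obtain ⟨a, rfl⟩ := hf
    refine ⟨a.smulRight a, fun v w => by simp [mul_comm], fun v => ?_⟩
    simp [indicator_eq_one_sub_pow, hF, sq]
  | zero => exact ⟨0, by simp, by simp⟩
  | add f g _ _ hf hg =>
    obtain ⟨φ, hφs, hφ⟩ := hf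
    obtain ⟨ψ, hψs, hψ⟩ := hg
    refine ⟨φ + ψ, fun v w => by simp [hφs v w, hψs v w], fun v => ?_⟩
    simp only [Pi.add_apply, LinearMap.add_apply]
    linear_combination hφ v + hψ v
  | smul r f _ hf =>
    obtain ⟨φ, hφs, hφ⟩ := hf
    refine ⟨r • φ, fun v w => by simp [hφs v w], fun v => ?_⟩
    simp only [Pi.smul_apply, LinearMap.smul_apply, smul_eq_mul]
    linear_combination r * hφ v

end HyperplaneFunctions

section Bridge

variable {V : Type*} [AddCommGroup V] [Module F V]

theorem exists_ker_eq [FiniteDimensional F V] {W : Submodule F V}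
    (hW : Module.finrank F W + 1 = Module.finrank F V) :
    ∃ a : V →ₗ[F] F, LinearMap.ker a = W := by
  have hlt : W < ⊤ := lt_top_iff_ne_top.2 fun h => by
    rw [h, finrank_top] at hW; omega
  obtain ⟨a, ha, hle⟩ := W.exists_le_ker_of_lt_top hlt
  refine ⟨a, (Submodule.eq_of_le_of_finrank_eq hle ?_).symm⟩
  have h1 := LinearMap.finrank_range_add_finrank_ker a
  have h2 : Module.finrank F (LinearMap.range a) = 1 := by
    rw [LinearMap.range_eq_top.2 (LinearMap.surjective ha), finrank_top, Module.finrank_self]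
  omega

theorem ptIn_mk {n : ℕ} {v : Fin (n + 1) → F} (hv : v ≠ 0)
    (W : Submodule F (Fin (n + 1) → F)) : ptIn (Projectivization.mk F v hv) W ↔ v ∈ W := by
  rw [ptIn, Projectivization.submodule_mk, Submodule.span_singleton_le_iff_mem]

/-- Every code word is given on nonzero vectors by a combination of hyperplane indicators. -/
theorem exists_hypFun {p n : ℕ} (ι : ZMod p →+* F) {c : Pt F n → ZMod p} (hc : c ∈ code F p n) :
    ∃ C ∈ hypFun F (Fin (n + 1) → F), ∀ v (hv : v ≠ 0),
      C v = ι (c (Projectivization.mk F v hv)) := by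
  induction hc using Submodule.span_induction with
  | mem f hf =>
    obtain ⟨W, hW, rfl⟩ := hf
    obtain ⟨a, rfl⟩ := exists_ker_eq (W := W) (by simp [hW])
    refine ⟨_, Submodule.subset_span ⟨a, rfl⟩, fun v hv => ?_⟩
    simp only [incVec, ptIn_mk, LinearMap.mem_ker]
    split_ifs <;> simp
  | zero => exact ⟨0, zero_mem _, by simp⟩
  | add f g _ _ hf hg =>
    obtain ⟨C, hC, hCf⟩ := hf
    obtain ⟨D, hD, hDg⟩ := hg
    exact ⟨C + D, add_mem hC hD, fun v hv => by simp [hCf v hv, hDg v hv]⟩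
  | smul r f _ hf =>
    obtain ⟨C, hC, hCf⟩ := hf
    exact ⟨ι r • C, Submodule.smul_mem _ _ hC, fun v hv => by simp [hCf v hv]⟩

end Bridge

section Triple

/-- The common local form of a code word of type `T^△` (with `h = 0`) or of type `T^odd`
(with `m₁ = m₂ + m₃`), where `m₁ = 0`, `m₂ = 0`, `m₃ = 0` are the three lines. -/
def tripleVal (b₁ b₂ b₃ m₁ m₂ m₃ h : F) : F :=
  (if m₁ = 0 then b₁ + h / m₂ else 0) + (if m₂ = 0 then b₂ + h / m₁ else 0) +
    (if m₃ = 0 then b₃ - h / m₂ else 0)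

theorem tripleVal_swap {b₁ b₂ b₃ m₁ m₂ m₃ h : F} (hm : h = 0 ∨ m₁ = m₂ + m₃) :
    tripleVal b₁ b₂ b₃ m₁ m₂ m₃ h = tripleVal b₂ b₁ b₃ m₂ m₁ (-m₃) h := by
  rcases hm with rfl | rfl
  · simp only [tripleVal, neg_eq_zero]; ring_nf
  · simp only [tripleVal, neg_eq_zero]
    by_cases h3 : m₃ = 0
    · simp only [h3, add_zero, if_true]; ring
    · simp only [h3, if_false]; ring

variable [Fintype F]

theorem sum_mul_tripleVal {g : F → F} (hg : ∑ x, g x = 0) {b₁ b₂ b₃ m₁ m₂ m₃ h : F}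
    (hm : m₂ ≠ 0 ∨ h = 0) :
    ∑ y, g y * tripleVal b₁ b₂ b₃ (y + m₁) m₂ (y + m₃) h =
      g (-m₁) * (b₁ + h / m₂) + g (-m₃) * (b₃ - h / m₂) := by
  simp only [tripleVal, mul_add, Finset.sum_add_distrib, add_eq_zero_iff_eq_neg]
  have : ∑ y, g y * (if m₂ = 0 then b₂ + h / (y + m₁) else 0) = 0 := by
    rcases eq_or_ne m₂ 0 with h2 | h2
    · obtain rfl : h = 0 := hm.resolve_left (not_not.2 h2)
      simp [h2, ← Finset.sum_mul, hg]
    · simp [h2]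
  rw [this]
  simp [mul_add]

theorem sum_mul_tripleVal_of_eq_zero {g : F → F} (hg : ∑ x, g x = 0) {b₁ b₂ b₃ m h : F} :
    ∑ y, g y * tripleVal b₁ b₂ b₃ (y + m) 0 (y + m) h =
      g (-m) * (b₁ + b₃) + h * ∑ y, g (y - m) / y := by
  have h1 : ∀ y, g y * tripleVal b₁ b₂ b₃ (y + m) 0 (y + m) h =
      (if y = -m then g y * (b₁ + b₃) else 0) + b₂ * g y + h * (g ((y + m) - m) / (y + m)) := by
    intro y
    simp only [tripleVal, add_eq_zero_iff_eq_neg, add_sub_cancel_right]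
    split_ifs <;> simp <;> ring_nf
  simp only [h1, Finset.sum_add_distrib, ← Finset.mul_sum, hg, mul_zero, add_zero]
  have h2 := Equiv.sum_comp (Equiv.addRight m) (fun y => g (y - m) / y)
  simp only [Equiv.coe_addRight] at h2
  rw [h2]
  simp

theorem sum_inv_eq_zero (hF : 2 < Fintype.card F) : ∑ y : F, y⁻¹ = 0 := by
  rw [← sum_pow_eq_zero (F := F) (j := 1) (by omega)]
  exact Fintype.sum_equiv (Equiv.inv F) _ _ (by simp)

theorem sum_div_self : ∑ y : F, y / y = -1 := by
  have : ∀ y : F, y / y = 1 - if y = 0 then 1 else 0 := by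
    intro y; split_ifs with hy <;> simp [hy]
  simp [this]

theorem sum_id_mul_tripleVal (hF : 2 < Fintype.card F) {b₁ b₂ b₃ m₁ m₂ m₃ h : F}
    (hm : h = 0 ∨ m₁ = m₂ + m₃) :
    ∑ y, y * tripleVal b₁ b₂ b₃ (y + m₁) m₂ (y + m₃) h = -(b₁ * m₁ + b₃ * m₃) - h := by
  have h1 : ∑ x : F, x = 0 := by simpa using sum_pow_eq_zero (F := F) (j := 1) (by omega)
  by_cases hh : h = 0
  · rw [sum_mul_tripleVal (g := fun x => x) h1 (Or.inr hh), hh]; ring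
  obtain rfl := hm.resolve_left hh
  by_cases h2 : m₂ = 0
  · subst h2
    rw [zero_add, sum_mul_tripleVal_of_eq_zero (g := fun x => x) h1]
    have h3 : ∀ y : F, (y - m₃) / y = y / y - m₃ * y⁻¹ := by
      intro y; rw [sub_div, div_eq_mul_inv m₃]
    simp only [h3, Finset.sum_sub_distrib, ← Finset.mul_sum, sum_div_self, sum_inv_eq_zero hF]
    ring
  · rw [sum_mul_tripleVal (g := fun x => x) h1 (Or.inl h2)]
    field_simp
    ring

theorem sum_sq_mul_tripleVal (hF : 3 < Fintype.card F) {b₁ b₂ b₃ m₁ m₂ m₃ h : F}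
    (hm : h = 0 ∨ m₁ = m₂ + m₃) :
    ∑ y, y ^ 2 * tripleVal b₁ b₂ b₃ (y + m₁) m₂ (y + m₃) h =
      b₁ * m₁ ^ 2 + b₃ * m₃ ^ 2 + h * (m₁ + m₃) := by
  have h1 : ∑ x : F, x = 0 := by simpa using sum_pow_eq_zero (F := F) (j := 1) (by omega)
  have h2 : ∑ x : F, x ^ 2 = 0 := sum_pow_eq_zero (by omega)
  by_cases hh : h = 0
  · rw [sum_mul_tripleVal (g := fun x => x ^ 2) h2 (Or.inr hh), hh]; ring
  obtain rfl := hm.resolve_left hh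
  by_cases hz : m₂ = 0
  · subst hz
    rw [zero_add, sum_mul_tripleVal_of_eq_zero (g := fun x => x ^ 2) h2]
    have h3 : ∀ y : F, (y - m₃) ^ 2 / y = y - 2 * m₃ * (y / y) + m₃ ^ 2 * y⁻¹ := by
      intro y
      by_cases hy : y = 0
      · simp [hy]
      · field_simp; ring
    simp only [h3, Finset.sum_add_distrib, Finset.sum_sub_distrib, ← Finset.mul_sum,
      sum_div_self, h1, sum_inv_eq_zero (F := F) (by omega)]
    ring
  · rw [sum_mul_tripleVal (g := fun x => x ^ 2) h2 (Or.inl hz)]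
    field_simp
    ring

theorem sum_cube_mul_tripleVal (hF : 4 < Fintype.card F) {b₁ b₂ b₃ m₁ m₂ m₃ : F} :
    ∑ y, y ^ 3 * tripleVal b₁ b₂ b₃ (y + m₁) m₂ (y + m₃) 0 =
      -(b₁ * m₁ ^ 3 + b₃ * m₃ ^ 3) := by
  rw [sum_mul_tripleVal (g := fun x => x ^ 3) (sum_pow_eq_zero (by omega)) (Or.inr rfl)]
  ring

end Triple

section Structure

variable {p q n : ℕ} [Fact p.Prime]

theorem oddBase_mk {η : Fin 3 → ZMod p} (hη : η ≠ 0) :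
    oddBase p (Projectivization.mk (ZMod p) η hη) =
      (if η 0 = 0 then η 2 / η 1 else 0) + (if η 1 = 0 then η 2 / η 0 else 0) -
        (if η 0 = η 1 then η 2 / η 0 else 0) := by
  obtain ⟨a, ha⟩ := Projectivization.exists_smul_eq_mk_rep (ZMod p) η hη
  have hr : ∀ i, (Projectivization.mk (ZMod p) η hη).rep i = a * η i := fun i => by
    rw [← ha]; rfl
  have ha0 : (a : ZMod p) ≠ 0 := a.ne_zero
  simp only [oddBase, hr, mul_eq_zero, ha0, false_or, mul_div_mul_left _ _ ha0,
    mul_right_inj' ha0]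
  by_cases h0 : η 0 = 0 <;> by_cases h1 : η 1 = 0
  · simp [h0, h1]
  · simp [h0, h1, Ne.symm h1]
  · simp [h0, h1]
  · by_cases h2 : η 0 = η 1
    · simp [h1, h2]
    · simp [h0, h1, h2]

theorem oddWord_mk (g : (Fin 3 → ZMod p) ≃ₗ[ZMod p] (Fin 3 → ZMod p)) (γ a b d : ZMod p)
    {ζ : Fin 3 → ZMod p} (hζ : ζ ≠ 0) :
    oddWord p g γ a b d (Projectivization.mk (ZMod p) ζ hζ) =
      (if g ζ 0 = 0 then a + γ * g ζ 2 / g ζ 1 else 0) +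
        (if g ζ 1 = 0 then b + γ * g ζ 2 / g ζ 0 else 0) +
        (if g ζ 0 = g ζ 1 then d - γ * g ζ 2 / g ζ 0 else 0) := by
  have hη : g ζ ≠ 0 := by simpa using hζ
  have hmap : Projectivization.map g.toLinearMap g.injective
      (Projectivization.mk (ZMod p) ζ hζ) = Projectivization.mk (ZMod p) (g ζ) hη := rfl
  simp only [oddWord, hmap, oddBase_mk, incVec, ptIn_mk, lineM1, lineM2, lineM3,
    LinearMap.mem_ker, LinearMap.proj_apply, LinearMap.sub_apply, sub_eq_zero]
  split_ifs <;> ring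

theorem planeEmbed_mk (σ : ZMod p →+* F) (b : Fin 3 → (Fin (n + 1) → F))
    (hb : LinearIndependent F b) {ζ : Fin 3 → ZMod p} (hζ : ζ ≠ 0)
    (hz : ∑ i, σ (ζ i) • b i ≠ 0) :
    planeEmbed σ b hb (Projectivization.mk (ZMod p) ζ hζ) =
      Projectivization.mk F (∑ i, σ (ζ i) • b i) hz := by
  obtain ⟨a, ha⟩ := Projectivization.exists_smul_eq_mk_rep (ZMod p) ζ hζ
  rw [planeEmbed, Projectivization.mk_eq_mk_iff']
  refine ⟨σ a, ?_⟩
  rw [← ha, Finset.smul_sum]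
  refine Finset.sum_congr rfl fun i _ => ?_
  rw [smul_smul, ← map_mul]
  rfl

variable [Fintype F]

/-- On a subspace of type `T` the word is a cone over a plane of type `T`: it factors through a
projection onto that plane. -/
theorem SpaceIsType.exists_proj (hn : 3 ≤ n) {ι : ZMod p →+* F} {c : Pt F n → ZMod p}
    {C : (Fin (n + 1) → F) → F} (hC : C ∈ hypFun F (Fin (n + 1) → F))
    (hCc : ∀ v (hv : v ≠ 0), C v = ι (c (Projectivization.mk F v hv)))
    {H : Submodule F (Fin (n + 1) → F)} {t : PlaneT} (hT : SpaceIsType p q c H (n - 1) t) :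
    ∃ W : Submodule F (Fin (n + 1) → F), IsPlane W ∧ W ≤ H ∧ PlaneIsType p q c W t ∧
      ∃ pr : (Fin (n + 1) → F) →ₗ[F] (Fin (n + 1) → F),
        (∀ z ∈ W, pr z = z) ∧ (∀ v, pr v ∈ W) ∧ ∀ v ∈ H, C v = C (pr v) := by
  obtain ⟨hH, κ, hκ, hκH, -, W, hW, hWH, hWκ, hWt, hcone⟩ := hT
  refine ⟨W, hW, hWH, hWt, ?_⟩
  have hsup : W ⊔ κ = H := by
    refine Submodule.eq_of_le_of_finrank_eq (sup_le hWH hκH) ?_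
    have := Submodule.finrank_sup_add_finrank_inf_eq W κ
    rw [hWκ, finrank_bot, hW, hκ] at this
    omega
  obtain ⟨g, hg⟩ := (κ.mkQ ∘ₗ W.subtype).exists_leftInverse_of_injective (by
    refine LinearMap.ker_eq_bot'.2 fun z hz => Subtype.ext ?_
    have : (z : Fin (n + 1) → F) ∈ W ⊓ κ := ⟨z.2, (Submodule.Quotient.mk_eq_zero κ).1 hz⟩
    rwa [hWκ] at this)
  let pr : (Fin (n + 1) → F) →ₗ[F] (Fin (n + 1) → F) := W.subtype ∘ₗ g ∘ₗ κ.mkQ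
  have hprW : ∀ z ∈ W, pr z = z := fun z hz =>
    congrArg Subtype.val (LinearMap.congr_fun hg ⟨z, hz⟩)
  have hprκ : ∀ z ∈ κ, pr z = 0 := fun z hz => by
    simp [pr, (Submodule.Quotient.mk_eq_zero κ).2 hz]
  have hmem : ∀ v, pr v ∈ W := fun v => (g (κ.mkQ v)).2
  have hout : ∀ v ∈ H, v ∉ κ → C v = C (pr v) := by
    intro v hv hvκ
    have hv0 : v ≠ 0 := fun h => hvκ (h ▸ zero_mem κ)
    obtain ⟨Q, hQW, hQ, hPQ⟩ := hcone (Projectivization.mk F v hv0) ((ptIn_mk hv0 H).2 hv)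
      (fun h => hvκ ((ptIn_mk hv0 κ).1 h))
    induction Q using Projectivization.ind with
    | h z hz =>
      rw [ptIn_mk] at hQW
      rw [Projectivization.submodule_mk, Projectivization.submodule_mk,
        Submodule.span_singleton_le_iff_mem, Submodule.mem_sup] at hQ
      obtain ⟨k, hk, y, hy, rfl⟩ := hQ
      obtain ⟨μ, rfl⟩ := Submodule.mem_span_singleton.1 hy
      have hz' : k + μ • v = μ • pr v := by
        rw [← hprW _ hQW, map_add, hprκ k hk, map_smul, zero_add]
      have hμ : μ ≠ 0 := by
        rintro rfl
        exact hz (by rw [hz', zero_smul])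
      rw [hCc v hv0, hPQ, ← hCc, hz', hypFun_smul hC hμ]
  refine ⟨pr, hprW, hmem, fun v hv => ?_⟩
  by_cases hvκ : v ∈ κ
  · have : Nontrivial W := Module.nontrivial_of_finrank_pos (R := F) (by rw [hW]; norm_num)
    obtain ⟨⟨e, heW⟩, he⟩ := exists_ne (0 : W)
    have he0 : e ≠ 0 := fun h => he (Subtype.ext h)
    have h1 := hypFun_sum_line hC e v
    have h2 : ∀ x : F, C (x • e + v) = C e + if x = 0 then C v - C e else 0 := by
      intro x
      split_ifs with hx
      · simp [hx]
      · rw [hout _ (add_mem (H.smul_mem x (hWH heW)) hv), map_add, map_smul, hprW e heW,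
          hprκ v hvκ, add_zero, add_zero, hypFun_smul hC hx]
        intro hmemκ
        have h3 : x • e ∈ κ := by simpa using sub_mem hmemκ hvκ
        have h4 : e ∈ W ⊓ κ := ⟨heW, by simpa [hx] using κ.smul_mem x⁻¹ h3⟩
        rw [hWκ] at h4
        exact he0 h4
    simp only [h2, Finset.sum_add_distrib, Finset.sum_const, Finset.card_univ, nsmul_eq_mul,
      Finset.sum_ite_eq', Finset.mem_univ, if_true, Nat.cast_card_eq_zero, zero_mul] at h1
    rw [hprκ v hvκ]
    linear_combination h1
  · exact hout v hv hvκ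

theorem TypeTri.exists_form {ι : ZMod p →+* F} {c : Pt F n → ZMod p}
    {C : (Fin (n + 1) → F) → F} (hC : C ∈ hypFun F (Fin (n + 1) → F))
    (hCc : ∀ v (hv : v ≠ 0), C v = ι (c (Projectivization.mk F v hv)))
    {W : Submodule F (Fin (n + 1) → F)} (hW : IsPlane W) (hT : TypeTri p c W) :
    ∃ (L₁ L₂ L₃ : (Fin (n + 1) → F) →ₗ[F] F) (a₁ a₂ a₃ : ZMod p),
      a₁ ≠ 0 ∧ a₂ ≠ 0 ∧ a₃ ≠ 0 ∧
      (∃ w ∈ W, L₁ w = 1 ∧ L₂ w = 0 ∧ L₃ w = 0) ∧ (∃ w ∈ W, L₁ w = 0 ∧ L₂ w = 1 ∧ L₃ w = 0) ∧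
      (∃ w ∈ W, L₁ w = 0 ∧ L₂ w = 0 ∧ L₃ w = 1) ∧
      ∀ z ∈ W, C z = (if L₁ z = 0 then ι a₁ else 0) + (if L₂ z = 0 then ι a₂ else 0) +
        (if L₃ z = 0 then ι a₃ else 0) := by
  obtain ⟨l₁, l₂, l₃, h₁, h₂, h₃, hl₁, hl₂, hl₃, -, -, -, hcc, a₁, a₂, a₃, ha₁, ha₂, ha₃, hc⟩ := hT
  have meet : ∀ l l' : Submodule F (Fin (n + 1) → F), IsLine l → IsLine l' → l ≤ W → l' ≤ W →
      ∃ w, w ≠ 0 ∧ w ∈ l ∧ w ∈ l' := by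
    intro l l' h h' hl hl'
    have h4 := Submodule.finrank_sup_add_finrank_inf_eq l l'
    have h5 := Submodule.finrank_mono (sup_le hl hl')
    rw [h, h'] at h4
    rw [hW] at h5
    obtain ⟨w, hw, hw0⟩ := (Submodule.ne_bot_iff _).1
      (show l ⊓ l' ≠ ⊥ from fun h => by rw [h, finrank_bot] at h4; omega)
    exact ⟨w, hw0, hw.1, hw.2⟩
  have form : ∀ (l : Submodule F (Fin (n + 1) → F)) (w : Fin (n + 1) → F), IsLine l → l ≤ W →
      w ∈ W → w ∉ l → ∃ L : (Fin (n + 1) → F) →ₗ[F] F, L w = 1 ∧ ∀ z ∈ W, L z = 0 ↔ z ∈ l := by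
    intro l w h hl hwW hwl
    obtain ⟨L, hLw, hLl⟩ := Submodule.exists_le_ker_of_notMem hwl
    have hl' : l = W ⊓ LinearMap.ker L := by
      refine Submodule.eq_of_le_of_finrank_le (le_inf hl hLl) ?_
      have : W ⊓ LinearMap.ker L < W := inf_le_left.lt_of_ne fun heq =>
        hLw (LinearMap.mem_ker.1 (inf_eq_left.1 heq hwW))
      have := Submodule.finrank_lt_finrank_of_lt this
      rw [hW] at this
      rw [h]
      omega
    refine ⟨(L w)⁻¹ • L, by simp [hLw], fun z hz => ?_⟩
    rw [hl']
    simp [hLw, hz]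
  obtain ⟨w₁, hw₁, hw₁₂, hw₁₃⟩ := meet l₂ l₃ h₂ h₃ hl₂ hl₃
  obtain ⟨w₂, hw₂, hw₂₁, hw₂₃⟩ := meet l₁ l₃ h₁ h₃ hl₁ hl₃
  obtain ⟨w₃, hw₃, hw₃₁, hw₃₂⟩ := meet l₁ l₂ h₁ h₂ hl₁ hl₂
  have hcc' : ∀ w, w ≠ 0 → w ∈ l₁ → w ∈ l₂ → w ∈ l₃ → False := fun w hw g₁ g₂ g₃ =>
    hcc ⟨Projectivization.mk F w hw, (ptIn_mk hw _).2 g₁, (ptIn_mk hw _).2 g₂, (ptIn_mk hw _).2 g₃⟩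
  obtain ⟨L₁, hL₁, hL₁'⟩ := form l₁ w₁ h₁ hl₁ (hl₂ hw₁₂) fun h => hcc' _ hw₁ h hw₁₂ hw₁₃
  obtain ⟨L₂, hL₂, hL₂'⟩ := form l₂ w₂ h₂ hl₂ (hl₁ hw₂₁) fun h => hcc' _ hw₂ hw₂₁ h hw₂₃
  obtain ⟨L₃, hL₃, hL₃'⟩ := form l₃ w₃ h₃ hl₃ (hl₁ hw₃₁) fun h => hcc' _ hw₃ hw₃₁ hw₃₂ h
  have z₂₁ := (hL₁' _ (hl₁ hw₂₁)).2 hw₂₁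
  have z₃₁ := (hL₁' _ (hl₁ hw₃₁)).2 hw₃₁
  have z₁₂ := (hL₂' _ (hl₂ hw₁₂)).2 hw₁₂
  have z₃₂ := (hL₂' _ (hl₂ hw₃₂)).2 hw₃₂
  have z₁₃ := (hL₃' _ (hl₃ hw₁₃)).2 hw₁₃
  have z₂₃ := (hL₃' _ (hl₃ hw₂₃)).2 hw₂₃
  have key : ∀ z ∈ W, z ≠ 0 → C z = (if L₁ z = 0 then ι a₁ else 0) +
      (if L₂ z = 0 then ι a₂ else 0) + (if L₃ z = 0 then ι a₃ else 0) := by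
    intro z hz hz0
    rw [hCc z hz0, hc _ ((ptIn_mk hz0 W).2 hz)]
    simp only [incVec, ptIn_mk, hL₁' z hz, hL₂' z hz, hL₃' z hz, mul_ite, mul_one, mul_zero,
      map_add, apply_ite ι, map_zero]
  refine ⟨L₁, L₂, L₃, a₁, a₂, a₃, ha₁, ha₂, ha₃, ⟨w₁, hl₂ hw₁₂, hL₁, z₁₂, z₁₃⟩,
    ⟨w₂, hl₁ hw₂₁, z₂₁, hL₂, z₂₃⟩, ⟨w₃, hl₁ hw₃₁, z₃₁, z₃₂, hL₃⟩, fun z hz => ?_⟩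
  rcases eq_or_ne z 0 with rfl | hz0
  · have h1 := hypFun_sum_line hC w₃ (w₁ + w₂)
    have h2 : ∀ x : F, C (x • w₃ + (w₁ + w₂)) = if x = 0 then ι a₃ else 0 := by
      intro x
      have e1 : L₁ (x • w₃ + (w₁ + w₂)) = 1 := by simp [hL₁, z₃₁, z₂₁]
      rw [key _ (add_mem (W.smul_mem x (hl₁ hw₃₁)) (add_mem (hl₂ hw₁₂) (hl₁ hw₂₁)))
        (fun h => by rw [h, map_zero] at e1; exact zero_ne_one e1), e1]
      simp [hL₂, hL₃, z₃₂, z₁₂, z₁₃, z₂₃]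
    simp only [h2, Finset.sum_ite_eq', Finset.mem_univ, if_true, key _ (hl₁ hw₃₁) hw₃, z₃₁, z₃₂,
      hL₃, one_ne_zero, if_false] at h1
    simp only [map_zero, if_true]
    linear_combination -h1
  · exact key z hz hz0

theorem TypeOdd.exists_form {ι : ZMod p →+* F} {c : Pt F n → ZMod p}
    {C : (Fin (n + 1) → F) → F} (hC : C ∈ hypFun F (Fin (n + 1) → F))
    (hCc : ∀ v (hv : v ≠ 0), C v = ι (c (Projectivization.mk F v hv)))
    {W : Submodule F (Fin (n + 1) → F)} (hT : TypeOdd p c W) :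
    ∃ (X₀ X₁ X₂ : (Fin (n + 1) → F) →ₗ[F] F) (γ a b d : ZMod p), γ ≠ 0 ∧
      (∃ w ∈ W, X₀ w = 1 ∧ X₁ w = 0 ∧ X₂ w = 0) ∧ (∃ w ∈ W, X₀ w = 0 ∧ X₁ w = 1 ∧ X₂ w = 0) ∧
      (∃ w ∈ W, X₀ w = 0 ∧ X₁ w = 0 ∧ X₂ w = 1) ∧
      ∀ z ∈ W, (z ≠ 0 ∨ 2 < Fintype.card F) →
        C z = (if X₀ z = 0 then ι a + ι γ * X₂ z / X₁ z else 0) +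
          (if X₁ z = 0 then ι b + ι γ * X₂ z / X₀ z else 0) +
          (if X₀ z = X₁ z then ι d - ι γ * X₂ z / X₀ z else 0) := by
  obtain ⟨hcard, σ, b, hb, hW, g, γ, lam, lam', lam'', hγ, hc⟩ := hT
  obtain rfl : σ = ι := Subsingleton.elim _ _
  have hbij : Function.Bijective σ := (Fintype.bijective_iff_injective_and_card σ).2
    ⟨σ.injective, by rw [hcard, ZMod.card]⟩
  obtain ⟨D, hD⟩ := (Fintype.linearCombination F b).exists_leftInverse_of_injective
    (LinearMap.ker_eq_bot.2 hb.fintypeLinearCombination_injective)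
  let comb : (Fin 3 → ZMod p) → (Fin (n + 1) → F) := fun ζ => ∑ i, σ (ζ i) • b i
  have hcombW : ∀ ζ, comb ζ ∈ W := fun ζ => by
    rw [← hW]
    exact sum_mem fun i _ => Submodule.smul_mem _ _ (Submodule.subset_span ⟨i, rfl⟩)
  have hDcomb : ∀ ζ, D (comb ζ) = fun i => σ (ζ i) := fun ζ =>
    LinearMap.congr_fun hD (fun i => σ (ζ i))
  have hsurj : ∀ z ∈ W, ∃ ζ, z = comb ζ := by
    intro z hz
    rw [← hW, ← Fintype.range_linearCombination] at hz
    obtain ⟨y, rfl⟩ := hz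
    choose ζ hζ using fun i => hbij.2 (y i)
    exact ⟨ζ, by simp [comb, hζ, Fintype.linearCombination_apply]⟩
  let X : Fin 3 → (Fin (n + 1) → F) →ₗ[F] F := fun i =>
    ∑ j, σ (g (Pi.single j 1) i) • (LinearMap.proj j ∘ₗ D)
  have hX : ∀ i ζ, X i (comb ζ) = σ (g ζ i) := by
    intro i ζ
    have h1 : g ζ = ∑ j, ζ j • g (Pi.single j 1) := by
      conv_lhs => rw [pi_eq_sum_univ' ζ]
      rw [map_sum]
      refine Finset.sum_congr rfl fun j _ => ?_
      rw [map_smul]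
    rw [h1]
    simp [X, hDcomb, Finset.sum_apply, map_sum, mul_comm]
  have hw : ∀ k i, X i (comb (g.symm (Pi.single k 1))) = if i = k then 1 else 0 := by
    intro k i
    rw [hX, LinearEquiv.apply_symm_apply, Pi.single_apply]
    split_ifs <;> simp
  have key : ∀ z ∈ W, z ≠ 0 → C z = (if X 0 z = 0 then σ lam + σ γ * X 2 z / X 1 z else 0) +
      (if X 1 z = 0 then σ lam' + σ γ * X 2 z / X 0 z else 0) +
      (if X 0 z = X 1 z then σ lam'' - σ γ * X 2 z / X 0 z else 0) := by
    intro z hz hz0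
    obtain ⟨ζ, rfl⟩ := hsurj z hz
    have hζ : ζ ≠ 0 := by
      rintro rfl
      exact hz0 (by simp [comb])
    rw [hCc _ hz0, ← planeEmbed_mk σ b hb hζ, hc, oddWord_mk]
    simp only [hX, map_add, apply_ite σ, map_zero, map_sub, map_mul, map_div₀, map_eq_zero,
      σ.injective.eq_iff]
  refine ⟨X 0, X 1, X 2, γ, lam, lam', lam'', hγ, ⟨_, hcombW _, hw 0 0, hw 0 1, hw 0 2⟩,
    ⟨_, hcombW _, hw 1 0, hw 1 1, hw 1 2⟩, ⟨_, hcombW _, hw 2 0, hw 2 1, hw 2 2⟩, fun z hz h => ?_⟩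
  rcases eq_or_ne z 0 with rfl | hz0
  · have hF := h.resolve_left (not_not.2 rfl)
    have h0 := hw 2 0
    have h1 := hw 2 1
    have h2 := hw 2 2
    have h0' := hw 1 0
    have h1' := hw 1 1
    have h2' := hw 1 2
    have hWw := hcombW (g.symm (Pi.single 2 1))
    have hWw' := hcombW (g.symm (Pi.single 1 1))
    generalize comb (g.symm (Pi.single 2 1)) = w at *
    generalize comb (g.symm (Pi.single 1 1)) = w' at *
    simp only [show (0 : Fin 3) ≠ 2 by decide, show (1 : Fin 3) ≠ 2 by decide,
      show (0 : Fin 3) ≠ 1 by decide, show (2 : Fin 3) ≠ 1 by decide, if_true, if_false]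
      at h0 h1 h2 h0' h1' h2'
    have hs := hypFun_sum_line hC w w'
    have h3 : ∀ x : F, C (x • w + w') = σ lam + σ γ * x := by
      intro x
      have e1 : X 1 (x • w + w') = 1 := by simp [h1, h1']
      rw [key _ (add_mem (W.smul_mem x hWw) hWw')
        (fun h => by rw [h, map_zero] at e1; exact zero_ne_one e1), e1]
      simp [h0, h0', h2, h2']
    have hwne : w ≠ 0 := fun h => by rw [h, map_zero] at h2; exact zero_ne_one h2
    have h4 : ∑ x : F, σ γ * x = 0 := by
      have : ∑ x : F, x = 0 := by simpa using sum_pow_eq_zero (F := F) (j := 1) (by omega)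
      rw [← Finset.mul_sum, this, mul_zero]
    simp only [h3, Finset.sum_add_distrib, h4, Finset.sum_const,
      Finset.card_univ, nsmul_eq_mul, Nat.cast_card_eq_zero, key w hWw hwne, h0, h1, div_zero,
      if_true] at hs
    simp only [map_zero, if_true, div_zero]
    linear_combination -hs
  · exact key z hz hz0

end Structure
section LocalForm

/-- The value at a vector of a word of type `T^△` (with `h = 0`) or of type `T^odd` (with
`n₁ + n₂ + n₃ = 0`), in a cyclically symmetric form. -/
def cycVal (a₁ a₂ a₃ n₁ n₂ n₃ h : F) : F :=
  (if n₁ = 0 then a₁ + h / n₂ else 0) + (if n₂ = 0 then a₂ + h / n₃ else 0) +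
    (if n₃ = 0 then a₃ + h / n₁ else 0)

theorem cycVal_rotate (a₁ a₂ a₃ n₁ n₂ n₃ h : F) :
    cycVal a₁ a₂ a₃ n₁ n₂ n₃ h = cycVal a₂ a₃ a₁ n₂ n₃ n₁ h := by
  simp only [cycVal]; abel

theorem cycVal_swap {a₁ a₂ a₃ n₁ n₂ n₃ h : F} (hn : h = 0 ∨ n₁ + n₂ + n₃ = 0) :
    cycVal a₁ a₂ a₃ n₁ n₂ n₃ h = cycVal a₂ a₁ a₃ n₂ n₁ n₃ (-h) := by
  rcases hn with rfl | hn
  · simp only [cycVal, neg_zero, zero_div]; abel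
  · have e1 : n₁ = 0 → h / n₂ = -h / n₃ := by
      intro h0
      rw [show n₃ = -n₂ by linear_combination hn - h0, neg_div_neg_eq]
    have e2 : n₂ = 0 → h / n₃ = -h / n₁ := by
      intro h0
      rw [show n₃ = -n₁ by linear_combination hn - h0, div_neg, neg_div]
    have e3 : n₃ = 0 → h / n₁ = -h / n₂ := by
      intro h0
      rw [show n₂ = -n₁ by linear_combination hn - h0, neg_div_neg_eq]
    have c1 : (if n₁ = 0 then a₁ + h / n₂ else 0) = if n₁ = 0 then a₁ + -h / n₃ else 0 :=
      ite_congr rfl (fun h0 => by rw [e1 h0]) fun _ => rfl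
    have c2 : (if n₂ = 0 then a₂ + h / n₃ else 0) = if n₂ = 0 then a₂ + -h / n₁ else 0 :=
      ite_congr rfl (fun h0 => by rw [e2 h0]) fun _ => rfl
    have c3 : (if n₃ = 0 then a₃ + h / n₁ else 0) = if n₃ = 0 then a₃ + -h / n₂ else 0 :=
      ite_congr rfl (fun h0 => by rw [e3 h0]) fun _ => rfl
    rw [cycVal, c1, c2, c3, cycVal]
    abel

theorem cycVal_scale {a₁ a₂ a₃ m₁ m₂ m₃ h r s t : F} (hr : r ≠ 0) (hm : m₁ = m₂ + m₃) :
    cycVal a₁ a₂ a₃ (r * m₁) (-(r * m₂)) (-(r * m₃)) (-(r * (h + s * m₁ + t * m₂))) =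
      tripleVal (a₁ + t) (a₂ + s) (a₃ - s - t) m₁ m₂ m₃ h := by
  subst hm
  simp only [cycVal, tripleVal, neg_eq_zero, mul_eq_zero, hr, false_or, neg_div_neg_eq,
    mul_div_mul_left _ _ hr]
  by_cases h2 : m₂ = 0 <;> by_cases h3 : m₃ = 0
  · simp [h2, h3]; ring
  · simp [h2, h3]
    field_simp
    ring
  · simp [h2, h3]
    field_simp
    ring
  · by_cases h1 : m₂ + m₃ = 0
    · simp [h2, h3, h1]
      field_simp
      ring
    · simp [h2, h3, h1]

/-- A vector of a `3`-secant in the support of the word is killed by one of the three linear forms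
not vanishing on the secant. -/
theorem exists_active (hF : ∀ s : Finset F, s.card ≤ 6 → ∃ x, x ∉ s)
    {a₁ a₂ a₃ α₁ α₂ α₃ β₁ β₂ β₃ η θ : F}
    (hn : (η = 0 ∧ θ = 0) ∨ (α₁ + α₂ + α₃ = 0 ∧ β₁ + β₂ + β₃ = 0))
    (h0 : ∀ x, x ≠ 0 → x ≠ 1 →
      cycVal a₁ a₂ a₃ (α₁ + x * β₁) (α₂ + x * β₂) (α₃ + x * β₃) (η + x * θ) = 0) {s t : F}
    (hst : cycVal a₁ a₂ a₃ (s * α₁ + t * β₁) (s * α₂ + t * β₂) (s * α₃ + t * β₃)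
      (s * η + t * θ) ≠ 0) :
    (s * α₁ + t * β₁ = 0 ∧ (α₁ ≠ 0 ∨ β₁ ≠ 0)) ∨ (s * α₂ + t * β₂ = 0 ∧ (α₂ ≠ 0 ∨ β₂ ≠ 0)) ∨
      (s * α₃ + t * β₃ = 0 ∧ (α₃ ≠ 0 ∨ β₃ ≠ 0)) := by
  obtain ⟨x, hx⟩ := hF {0, 1, -α₁ / β₁, -α₂ / β₂, -α₃ / β₃} (Finset.card_le_five.trans (by norm_num))
  obtain ⟨y, hy⟩ := hF {0, 1, -α₁ / β₁, -α₂ / β₂, -α₃ / β₃, x} Finset.card_le_six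
  simp only [Finset.mem_insert, Finset.mem_singleton, not_or] at hx hy
  have hne : ∀ {x α β : F}, x ≠ -α / β → (α ≠ 0 ∨ β ≠ 0) → α + x * β ≠ 0 := by
    intro x α β h1 h2 h3
    by_cases hβ : β = 0
    · rw [hβ, mul_zero, add_zero] at h3
      exact h2.elim (fun h => h h3) (fun h => h hβ)
    · exact h1 (by rw [eq_div_iff hβ]; linear_combination h3)
  by_contra! hcon
  obtain ⟨c1, c2, c3⟩ := hcon
  have hx0 := h0 x hx.1 hx.2.1
  have hy0 := h0 y hy.1 hy.2.1
  have single : ∀ {a α β : F}, (α ≠ 0 ∨ β ≠ 0) → s * α + t * β ≠ 0 → x ≠ -α / β → y ≠ -α / β →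
      a + (η + x * θ) / (α + x * β) = 0 → a + (η + y * θ) / (α + y * β) = 0 →
      a + (s * η + t * θ) / (s * α + t * β) = 0 := by
    intro a α β hαβ hs hxα hyα hxa hya
    have h1 := hne hxα hαβ
    have h2 := hne hyα hαβ
    rw [add_div' _ _ _ h1, div_eq_zero_iff, or_iff_left h1] at hxa
    rw [add_div' _ _ _ h2, div_eq_zero_iff, or_iff_left h2] at hya
    rw [add_div' _ _ _ hs, div_eq_zero_iff, or_iff_left hs]
    have h3 : a * β + θ = 0 := by
      have : (y - x) * (a * β + θ) = 0 := by linear_combination hya - hxa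
      exact (mul_eq_zero.1 this).resolve_left (sub_ne_zero.2 hy.2.2.2.2.2)
    linear_combination (t - s * x) * h3 + s * hxa
  have dich : ∀ α β : F, (α = 0 ∧ β = 0) ∨ (α ≠ 0 ∨ β ≠ 0) := fun α β =>
    or_iff_not_imp_left.2 not_and_or.1
  have k1 := fun h => hne hx.2.2.1 (α := α₁) (β := β₁) h
  have k2 := fun h => hne hx.2.2.2.1 (α := α₂) (β := β₂) h
  have k3 := fun h => hne hx.2.2.2.2 (α := α₃) (β := β₃) h
  have j1 := fun h => hne hy.2.2.1 (α := α₁) (β := β₁) h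
  have j2 := fun h => hne hy.2.2.2.1 (α := α₂) (β := β₂) h
  have j3 := fun h => hne hy.2.2.2.2.1 (α := α₃) (β := β₃) h
  have c1' : (α₁ ≠ 0 ∨ β₁ ≠ 0) → s * α₁ + t * β₁ ≠ 0 :=
    fun h h' => h.elim (fun g => g (c1 h').1) fun g => g (c1 h').2
  have c2' : (α₂ ≠ 0 ∨ β₂ ≠ 0) → s * α₂ + t * β₂ ≠ 0 :=
    fun h h' => h.elim (fun g => g (c2 h').1) fun g => g (c2 h').2
  have c3' : (α₃ ≠ 0 ∨ β₃ ≠ 0) → s * α₃ + t * β₃ ≠ 0 :=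
    fun h h' => h.elim (fun g => g (c3 h').1) fun g => g (c3 h').2
  rcases dich α₁ β₁ with ⟨rfl, rfl⟩ | d1 <;> rcases dich α₂ β₂ with ⟨rfl, rfl⟩ | d2 <;>
    rcases dich α₃ β₃ with ⟨rfl, rfl⟩ | d3
  · simp [cycVal] at hx0 hst
    exact hst hx0
  · obtain ⟨rfl, rfl⟩ := hn.resolve_right (by simpa [or_iff_not_imp_left] using d3)
    simp [cycVal, k3 d3, c3' d3] at hx0 hst
    exact hst hx0
  · obtain ⟨rfl, rfl⟩ := hn.resolve_right (by simpa [or_iff_not_imp_left] using d2)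
    simp [cycVal, k2 d2, c2' d2] at hx0 hst
    exact hst hx0
  · simp [cycVal, k2 d2, c2' d2, k3 d3, c3' d3, j2 d2, j3 d3] at hx0 hst hy0
    exact hst (single d2 (c2' d2) hx.2.2.2.1 hy.2.2.2.1 hx0 hy0)
  · obtain ⟨rfl, rfl⟩ := hn.resolve_right (by simpa [or_iff_not_imp_left] using d1)
    simp [cycVal, k1 d1, c1' d1] at hx0 hst
    exact hst hx0
  · simp [cycVal, k1 d1, c1' d1, k3 d3, c3' d3, j1 d1, j3 d3] at hx0 hst hy0
    exact hst (single d3 (c3' d3) hx.2.2.2.2 hy.2.2.2.2.1 hx0 hy0)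
  · simp [cycVal, k1 d1, c1' d1, k2 d2, c2' d2, j1 d1, j2 d2] at hx0 hst hy0
    exact hst (single d1 (c1' d1) hx.2.2.1 hy.2.2.1 hx0 hy0)
  · exact hst (by simp [cycVal, c1' d1, c2' d2, c3' d3])

variable {V : Type*} [AddCommGroup V] [Module F V]

/-- `C` is given on `H` by `cycVal`, for linear forms as they arise from a space of type `T^△`
or (if `odd`) `T^odd`. -/
def LocalForm (odd : Prop) (C : V → F) (H : Submodule F V) (N₁ N₂ N₃ h : V →ₗ[F] F)
    (a₁ a₂ a₃ : F) : Prop :=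
  (∀ v ∈ H, C v = cycVal a₁ a₂ a₃ (N₁ v) (N₂ v) (N₃ v) (h v)) ∧
    ((¬ odd ∧ h = 0 ∧ (∃ w ∈ H, N₁ w ≠ 0 ∧ N₂ w = 0 ∧ N₃ w = 0) ∧
        (∃ w ∈ H, N₁ w = 0 ∧ N₂ w ≠ 0 ∧ N₃ w = 0) ∧ ∃ w ∈ H, N₁ w = 0 ∧ N₂ w = 0 ∧ N₃ w ≠ 0) ∨
      (odd ∧ (∀ v, N₁ v + N₂ v + N₃ v = 0) ∧ ∃ w ∈ H, N₁ w = 0 ∧ N₂ w = 0 ∧ N₃ w = 0 ∧ h w ≠ 0))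

theorem LocalForm.rotate {odd : Prop} {C : V → F} {H : Submodule F V} {N₁ N₂ N₃ h : V →ₗ[F] F}
    {a₁ a₂ a₃ : F} (hL : LocalForm odd C H N₁ N₂ N₃ h a₁ a₂ a₃) :
    LocalForm odd C H N₂ N₃ N₁ h a₂ a₃ a₁ := by
  obtain ⟨hC, ⟨ho, hh, ⟨w₁, hw₁, p₁, p₂, p₃⟩, ⟨w₂, hw₂, q₁, q₂, q₃⟩, w₃, hw₃, r₁, r₂, r₃⟩ |
    ⟨ho, hs, w, hw, p₁, p₂, p₃, p⟩⟩ := hL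
  · exact ⟨fun v hv => by rw [hC v hv, cycVal_rotate], Or.inl ⟨ho, hh, ⟨w₂, hw₂, q₂, q₃, q₁⟩,
      ⟨w₃, hw₃, r₂, r₃, r₁⟩, w₁, hw₁, p₂, p₃, p₁⟩⟩
  · exact ⟨fun v hv => by rw [hC v hv, cycVal_rotate], Or.inr ⟨ho, fun v => by
      linear_combination hs v, w, hw, p₂, p₃, p₁, p⟩⟩

theorem LocalForm.swap {odd : Prop} {C : V → F} {H : Submodule F V} {N₁ N₂ N₃ h : V →ₗ[F] F}
    {a₁ a₂ a₃ : F} (hL : LocalForm odd C H N₁ N₂ N₃ h a₁ a₂ a₃) :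
    LocalForm odd C H N₂ N₁ N₃ (-h) a₂ a₁ a₃ := by
  obtain ⟨hC, ⟨ho, hh, ⟨w₁, hw₁, p₁, p₂, p₃⟩, ⟨w₂, hw₂, q₁, q₂, q₃⟩, w₃, hw₃, r₁, r₂, r₃⟩ |
    ⟨ho, hs, w, hw, p₁, p₂, p₃, p⟩⟩ := hL
  · exact ⟨fun v hv => by rw [hC v hv, cycVal_swap (Or.inl (by simp [hh])), LinearMap.neg_apply],
      Or.inl ⟨ho, by simp [hh], ⟨w₂, hw₂, q₂, q₁, q₃⟩, ⟨w₁, hw₁, p₂, p₁, p₃⟩, w₃, hw₃, r₂, r₁, r₃⟩⟩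
  · exact ⟨fun v hv => by rw [hC v hv, cycVal_swap (Or.inr (hs v)), LinearMap.neg_apply],
      Or.inr ⟨ho, fun v => by linear_combination hs v, w, hw, p₂, p₁, p₃, by simpa using p⟩⟩

/-- `C` is given on `H` by `tripleVal`, with forms normalised on the vectors `e₁` and `e₂`, so
that `e₁`, `e₂`, `e₁ + e₂` lie on one of the three subspaces each. -/
def NormalForm (odd : Prop) (C : V → F) (H : Submodule F V) (e₁ e₂ : V) (M₁ M₂ M₃ h : V →ₗ[F] F) :
    Prop :=
  (M₁ e₁ = 0 ∧ M₁ e₂ = 1) ∧ (M₂ e₁ = 1 ∧ M₂ e₂ = 0) ∧ (M₃ e₁ = -1 ∧ M₃ e₂ = 1) ∧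
    (h e₁ = 0 ∧ h e₂ = 0) ∧
    (∀ v ∈ H, C v = tripleVal (C e₁) (C e₂) (C (e₁ + e₂)) (M₁ v) (M₂ v) (M₃ v) (h v)) ∧
    ((¬ odd ∧ h = 0 ∧ ∃ w ∈ H, M₁ w ≠ M₂ w + M₃ w) ∨
      (odd ∧ (∀ v, M₁ v = M₂ v + M₃ v) ∧ ∃ w ∈ H, h w ≠ 0))

theorem NormalForm.swap {odd : Prop} {C : V → F} {H : Submodule F V} {e₁ e₂ : V}
    {M₁ M₂ M₃ h : V →ₗ[F] F} (hN : NormalForm odd C H e₁ e₂ M₁ M₂ M₃ h) :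
    NormalForm odd C H e₂ e₁ M₂ M₁ (-M₃) h := by
  obtain ⟨⟨h1, h2⟩, ⟨h3, h4⟩, ⟨h5, h6⟩, ⟨h7, h8⟩, hC, hM⟩ := hN
  refine ⟨⟨h4, h3⟩, ⟨h2, h1⟩, ⟨by simp [h6], by simp [h5]⟩, ⟨h8, h7⟩, fun v hv => ?_, ?_⟩
  · rw [hC v hv, tripleVal_swap, add_comm e₂, LinearMap.neg_apply]
    rcases hM with ⟨-, hM, -⟩ | ⟨-, hM, -⟩
    · simp [hM]
    · exact Or.inr (hM v)
  · rcases hM with ⟨ho, hh, w, hw, hM⟩ | ⟨ho, hM, hw⟩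
    · exact Or.inl ⟨ho, hh, w, hw, fun h => hM (by rw [LinearMap.neg_apply] at h; linear_combination -h)⟩
    · exact Or.inr ⟨ho, fun v => by rw [LinearMap.neg_apply]; linear_combination -hM v, hw⟩

theorem LocalForm.exists_normalForm {odd : Prop} {C : V → F} {H : Submodule F V}
    {N₁ N₂ N₃ h : V →ₗ[F] F} {a₁ a₂ a₃ : F} (hL : LocalForm odd C H N₁ N₂ N₃ h a₁ a₂ a₃)
    {e₁ e₂ : V} (he₁ : e₁ ∈ H) (he₂ : e₂ ∈ H) (h1 : N₁ e₁ = 0) (h2 : N₂ e₂ = 0)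
    (h3 : N₃ e₁ + N₃ e₂ = 0) (h1' : N₁ e₂ ≠ 0) (h2' : N₂ e₁ ≠ 0) (h3' : N₃ e₁ ≠ 0) :
    ∃ M₁ M₂ M₃ h, NormalForm odd C H e₁ e₂ M₁ M₂ M₃ h := by
  suffices ∃ M₁ M₂ M₃ h : V →ₗ[F] F, ∃ b₁ b₂ b₃ : F,
      (M₁ e₁ = 0 ∧ M₁ e₂ = 1) ∧ (M₂ e₁ = 1 ∧ M₂ e₂ = 0) ∧ (M₃ e₁ = -1 ∧ M₃ e₂ = 1) ∧
      (h e₁ = 0 ∧ h e₂ = 0) ∧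
      (∀ v ∈ H, C v = tripleVal b₁ b₂ b₃ (M₁ v) (M₂ v) (M₃ v) (h v)) ∧
      ((¬ odd ∧ h = 0 ∧ ∃ w ∈ H, M₁ w ≠ M₂ w + M₃ w) ∨
        (odd ∧ (∀ v, M₁ v = M₂ v + M₃ v) ∧ ∃ w ∈ H, h w ≠ 0)) by
    obtain ⟨M₁, M₂, M₃, h, b₁, b₂, b₃, ⟨m1, m1'⟩, ⟨m2, m2'⟩, ⟨m3, m3'⟩, ⟨m4, m4'⟩, hC, hM⟩ := this
    have c1 : C e₁ = b₁ := by rw [hC _ he₁]; simp [tripleVal, m1, m2, m3, m4]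
    have c2 : C e₂ = b₂ := by rw [hC _ he₂]; simp [tripleVal, m1', m2', m3', m4']
    have c3 : C (e₁ + e₂) = b₃ := by
      rw [hC _ (add_mem he₁ he₂)]; simp [tripleVal, m1, m2, m3, m4, m1', m2', m3', m4']
    exact ⟨M₁, M₂, M₃, h, ⟨m1, m1'⟩, ⟨m2, m2'⟩, ⟨m3, m3'⟩, ⟨m4, m4'⟩, by rwa [c1, c2, c3], hM⟩
  obtain ⟨hC, ⟨ho, hh, ⟨w, hw, p₁, p₂, p₃⟩, -⟩ | ⟨ho, hs, w, hw, p₁, p₂, p₃, p⟩⟩ := hL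
  · refine ⟨(N₁ e₂)⁻¹ • N₁, (N₂ e₁)⁻¹ • N₂, (N₃ e₂)⁻¹ • N₃, 0, a₁, a₂, a₃, ?_⟩
    have h3'' : N₃ e₂ ≠ 0 := fun h => h3' (by rwa [h, add_zero] at h3)
    refine ⟨by simp [h1, h1'], by simp [h2, h2'], ⟨?_, by simp [h3'']⟩, by simp, fun v hv => ?_,
      Or.inl ⟨ho, rfl, w, hw, by simp [p₂, p₃, p₁, h1']⟩⟩
    · rw [LinearMap.smul_apply, smul_eq_mul, eq_neg_of_add_eq_zero_left h3]
      field_simp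
    · rw [hC v hv]
      simp [cycVal, tripleVal, hh, h1', h2', h3'']
  · set r := N₁ e₂ with hr
    have hN₂ : N₂ e₁ = -r := by linear_combination hs e₁ + hs e₂ - h1 - h2 - h3
    have hN₃ : N₃ e₁ = r := by linear_combination hs e₁ - h1 - hN₂
    have hN₃' : N₃ e₂ = -r := by linear_combination h3 - hN₃
    set M₁ := r⁻¹ • N₁ with hM₁
    set M₂ := -(r⁻¹ • N₂) with hM₂
    set M₃ := -(r⁻¹ • N₃) with hM₃
    set k := -(r⁻¹ • h) with hk
    have m1 : M₁ e₁ = 0 := by simp [hM₁, h1]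
    have m1' : M₁ e₂ = 1 := by simp [hM₁, ← hr, h1']
    have m2 : M₂ e₁ = 1 := by simp [hM₂, hN₂, h1']
    have m2' : M₂ e₂ = 0 := by simp [hM₂, h2]
    have hM : ∀ v, M₁ v = M₂ v + M₃ v := fun v => by
      simp only [hM₁, hM₂, hM₃, LinearMap.neg_apply, LinearMap.smul_apply, smul_eq_mul]
      linear_combination r⁻¹ * hs v
    refine ⟨M₁, M₂, M₃, k - k e₂ • M₁ - k e₁ • M₂, a₁ + k e₁, a₂ + k e₂, a₃ - k e₂ - k e₁,
      ⟨m1, m1'⟩, ⟨m2, m2'⟩, ⟨by linear_combination -hM e₁ + m1 - m2, by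
        linear_combination -hM e₂ + m1' - m2'⟩, ⟨by simp [m1, m2], by simp [m1', m2']⟩,
      fun v hv => ?_, Or.inr ⟨ho, hM, w, hw, by simp [hM₁, hM₂, p₁, p₂, hk, p, h1']⟩⟩
    rw [hC v hv, ← cycVal_scale h1' (hM v)]
    congr 1
    · simp [hM₁, h1']
    · simp [hM₂, h1']
    · simp [hM₃, h1']
    · simp [hk, hM₁, hM₂]
      field_simp
      ring

theorem LocalForm.exists_normalForm_of_secant (hF : ∀ s : Finset F, s.card ≤ 6 → ∃ x, x ∉ s)
    {odd : Prop} {C : V → F} {H : Submodule F V}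
    {N₁ N₂ N₃ h : V →ₗ[F] F} {a₁ a₂ a₃ : F} (hL : LocalForm odd C H N₁ N₂ N₃ h a₁ a₂ a₃)
    {e₁ e₂ : V} (he₁ : e₁ ∈ H) (he₂ : e₂ ∈ H) (h1 : C e₁ ≠ 0) (h2 : C e₂ ≠ 0)
    (h3 : C (e₁ + e₂) ≠ 0) (h0 : ∀ x : F, x ≠ 0 → x ≠ 1 → C (e₁ + x • e₂) = 0) :
    ∃ M₁ M₂ M₃ h, NormalForm odd C H e₁ e₂ M₁ M₂ M₃ h := by
  have hn : (h e₁ = 0 ∧ h e₂ = 0) ∨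
      (N₁ e₁ + N₂ e₁ + N₃ e₁ = 0 ∧ N₁ e₂ + N₂ e₂ + N₃ e₂ = 0) := by
    rcases hL.2 with ⟨-, hh, -⟩ | ⟨-, hs, -⟩
    · exact Or.inl (by simp [hh])
    · exact Or.inr ⟨hs _, hs _⟩
  have hz : ∀ x, x ≠ 0 → x ≠ 1 → cycVal a₁ a₂ a₃ (N₁ e₁ + x * N₁ e₂) (N₂ e₁ + x * N₂ e₂)
      (N₃ e₁ + x * N₃ e₂) (h e₁ + x * h e₂) = 0 := fun x hx0 hx1 => by
    have := h0 x hx0 hx1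
    rw [hL.1 _ (add_mem he₁ (H.smul_mem x he₂))] at this
    simpa using this
  have k1 := exists_active hF hn hz (s := 1) (t := 0) (by simpa [← hL.1 _ he₁] using h1)
  have k2 := exists_active hF hn hz (s := 0) (t := 1) (by simpa [← hL.1 _ he₂] using h2)
  have k3 := exists_active hF hn hz (s := 1) (t := 1) (by
    rw [hL.1 _ (add_mem he₁ he₂)] at h3; simpa using h3)
  simp only [one_mul, zero_mul, add_zero, zero_add] at k1 k2 k3
  have act : ∀ {α β : F}, α = 0 ∧ (α ≠ 0 ∨ β ≠ 0) → α = 0 ∧ β ≠ 0 :=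
    fun h => ⟨h.1, h.2.resolve_left (not_not.2 h.1)⟩
  have act' : ∀ {α β : F}, β = 0 ∧ (α ≠ 0 ∨ β ≠ 0) → β = 0 ∧ α ≠ 0 :=
    fun h => ⟨h.1, h.2.resolve_right (not_not.2 h.1)⟩
  have act'' : ∀ {α β : F}, α + β = 0 ∧ (α ≠ 0 ∨ β ≠ 0) → α + β = 0 ∧ α ≠ 0 ∧ β ≠ 0 := by
    rintro α β ⟨h1, h2⟩
    obtain rfl := eq_neg_of_add_eq_zero_left h1
    simpa using h2
  rcases k1 with k1 | k1 | k1 <;> rcases k2 with k2 | k2 | k2 <;> rcases k3 with k3 | k3 | k3 <;>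
    obtain ⟨x1, y1⟩ := act k1 <;> obtain ⟨x2, y2⟩ := act' k2 <;> obtain ⟨x3, y3, z3⟩ := act'' k3 <;>
    first
      | contradiction
      | exact hL.exists_normalForm he₁ he₂ ‹_› ‹_› ‹_› ‹_› ‹_› ‹_›
      | exact hL.rotate.exists_normalForm he₁ he₂ ‹_› ‹_› ‹_› ‹_› ‹_› ‹_›
      | exact hL.rotate.rotate.exists_normalForm he₁ he₂ ‹_› ‹_› ‹_› ‹_› ‹_› ‹_›
      | exact hL.swap.exists_normalForm he₁ he₂ ‹_› ‹_› ‹_› ‹_› ‹_› ‹_›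
      | exact hL.swap.rotate.exists_normalForm he₁ he₂ ‹_› ‹_› ‹_› ‹_› ‹_› ‹_›
      | exact hL.swap.rotate.rotate.exists_normalForm he₁ he₂ ‹_› ‹_› ‹_› ‹_› ‹_› ‹_›

end LocalForm
section LargeField

theorem exists_hyperplane {n : ℕ} (hn : 3 ≤ n) {l K : Submodule F (Fin (n + 1) → F)}
    (hl : Module.finrank F l = 2) (hK : n ≤ Module.finrank F K) (hlK : l ≤ K) :
    ∃ H : Submodule F (Fin (n + 1) → F), Module.finrank F H = n ∧ l ≤ H ∧ H ≤ K := by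
  rcases eq_or_ne K ⊤ with rfl | hK'
  · have hlt : l < ⊤ := lt_top_iff_ne_top.2 fun h => by
      rw [h, finrank_top, Module.finrank_fin_fun] at hl; omega
    obtain ⟨f, hf, hlf⟩ := l.exists_le_ker_of_lt_top hlt
    have := Module.Dual.finrank_ker_add_one_of_ne_zero (K := F) hf
    rw [Module.finrank_fin_fun] at this
    exact ⟨LinearMap.ker f, by omega, hlf, le_top⟩
  · have := Submodule.finrank_lt hK'
    rw [Module.finrank_fin_fun] at this
    exact ⟨K, by omega, hlK, le_rfl⟩

theorem le_finrank_ker {n : ℕ} (f : (Fin (n + 1) → F) →ₗ[F] F) :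
    n ≤ Module.finrank F (LinearMap.ker f) := by
  have h1 := LinearMap.finrank_range_add_finrank_ker f
  have h2 := (LinearMap.range f).finrank_le
  rw [Module.finrank_fin_fun] at h1
  rw [Module.finrank_self] at h2
  omega

theorem SpaceIsType.exists_localForm {p q n : ℕ} [Fact p.Prime] [Fintype F]
    (hn : 3 ≤ n) (hF : 2 < Fintype.card F) {ι : ZMod p →+* F} {c : Pt F n → ZMod p}
    {C : (Fin (n + 1) → F) → F} (hC : C ∈ hypFun F (Fin (n + 1) → F))
    (hCc : ∀ v (hv : v ≠ 0), C v = ι (c (Projectivization.mk F v hv)))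
    {H : Submodule F (Fin (n + 1) → F)} {t : PlaneT} (ht : t = PlaneT.Todd ∨ t = PlaneT.Ttri)
    (hT : SpaceIsType p q c H (n - 1) t) :
    ∃ (N₁ N₂ N₃ h : (Fin (n + 1) → F) →ₗ[F] F) (a₁ a₂ a₃ : F),
      LocalForm (t = PlaneT.Todd) C H N₁ N₂ N₃ h a₁ a₂ a₃ := by
  obtain ⟨W, hW, hWH, hWt, pr, hpr, hprW, hprC⟩ := hT.exists_proj hn hC hCc
  rcases ht with rfl | rfl
  · obtain ⟨X₀, X₁, X₂, γ, a, b, d, hγ, -, -, ⟨w, hw, h0, h1, h2⟩, hX⟩ :=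
      TypeOdd.exists_form hC hCc hWt
    refine ⟨X₀ ∘ₗ pr, -(X₁ ∘ₗ pr), X₁ ∘ₗ pr - X₀ ∘ₗ pr, -(ι γ • (X₂ ∘ₗ pr)), ι a, ι b, ι d,
      fun v hv => ?_, Or.inr ⟨rfl, fun v => by
        simp only [LinearMap.comp_apply, LinearMap.neg_apply, LinearMap.sub_apply]; ring,
      w, hWH hw, ?_⟩⟩
    · rw [hprC v hv, hX _ (hprW v) (Or.inr hF)]
      simp only [cycVal, LinearMap.comp_apply, LinearMap.neg_apply, LinearMap.sub_apply,
        LinearMap.smul_apply, smul_eq_mul, neg_div_neg_eq, neg_eq_zero]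
      congr 1
      · congr 1
        refine ite_congr rfl (fun h => ?_) fun _ => rfl
        rw [h, zero_sub, neg_div_neg_eq]
      · refine ite_congr (by rw [sub_eq_zero]; exact propext eq_comm) (fun h => ?_) fun _ => rfl
        rw [neg_div, sub_eq_add_neg]
    · simp [hpr w hw, h0, h1, h2, hγ]
  · obtain ⟨L₁, L₂, L₃, a₁, a₂, a₃, -, -, -, ⟨w₁, hw₁, p₁, p₂, p₃⟩, ⟨w₂, hw₂, q₁, q₂, q₃⟩,
      ⟨w₃, hw₃, r₁, r₂, r₃⟩, hL⟩ := TypeTri.exists_form hC hCc hW hWt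
    refine ⟨L₁ ∘ₗ pr, L₂ ∘ₗ pr, L₃ ∘ₗ pr, 0, ι a₁, ι a₂, ι a₃, fun v hv => ?_,
      Or.inl ⟨by simp, rfl, ⟨w₁, hWH hw₁, ?_⟩, ⟨w₂, hWH hw₂, ?_⟩, ⟨w₃, hWH hw₃, ?_⟩⟩⟩
    · rw [hprC v hv, hL _ (hprW v)]
      simp [cycVal]
    · simp [hpr _ hw₁, p₁, p₂, p₃]
    · simp [hpr _ hw₂, q₁, q₂, q₃]
    · simp [hpr _ hw₃, r₁, r₂, r₃]

variable {V : Type*} [AddCommGroup V] [Module F V] {odd : Prop} {C : V → F} {H : Submodule F V}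
  {e₁ e₂ : V} {M₁ M₂ M₃ h : V →ₗ[F] F}

theorem NormalForm.eq_zero_or (hN : NormalForm odd C H e₁ e₂ M₁ M₂ M₃ h) (v : V) :
    h v = 0 ∨ M₁ v = M₂ v + M₃ v := by
  rcases hN.2.2.2.2.2 with ⟨-, hh, -⟩ | ⟨-, hM, -⟩
  · simp [hh]
  · exact Or.inr (hM v)

theorem NormalForm.apply_smul_add (hN : NormalForm odd C H e₁ e₂ M₁ M₂ M₃ h) (he₂ : e₂ ∈ H)
    {w : V} (hw : w ∈ H) (x : F) :
    C (x • e₂ + w) = tripleVal (C e₁) (C e₂) (C (e₁ + e₂)) (x + M₁ w) (M₂ w) (x + M₃ w) (h w) := by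
  obtain ⟨⟨-, h1⟩, ⟨-, h2⟩, ⟨-, h3⟩, ⟨-, h4⟩, hC, -⟩ := hN
  rw [hC _ (add_mem (H.smul_mem x he₂) hw)]
  simp [h1, h2, h3, h4]

variable [Fintype F]

theorem NormalForm.moment_one (hF : 2 < Fintype.card F)
    (hN : NormalForm odd C H e₁ e₂ M₁ M₂ M₃ h) (he₂ : e₂ ∈ H) {φ : V →ₗ[F] F}
    (hφ : ∀ w, ∑ x : F, x * C (x • e₂ + w) = φ w) {w : V} (hw : w ∈ H) :
    φ w = -(C e₁ * M₁ w + C (e₁ + e₂) * M₃ w) - h w := by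
  rw [← hφ]
  simp only [hN.apply_smul_add he₂ hw]
  exact sum_id_mul_tripleVal hF (hN.eq_zero_or w)

theorem NormalForm.moment_two (hF : 3 < Fintype.card F)
    (hN : NormalForm odd C H e₁ e₂ M₁ M₂ M₃ h) (he₁ : e₁ ∈ H) (he₂ : e₂ ∈ H)
    {β : V →ₗ[F] V →ₗ[F] F} (hβ : ∀ v w, β v w = β w v)
    (hβC : ∀ w, ∑ x : F, x ^ 2 * C (x • e₂ + w) = β w w) {w : V} (hw : w ∈ H) :
    2 * β e₁ w = -(2 * C (e₁ + e₂) * M₃ w) - h w := by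
  have key : ∀ w ∈ H, β w w = C e₁ * M₁ w ^ 2 + C (e₁ + e₂) * M₃ w ^ 2 + h w * (M₁ w + M₃ w) := by
    intro w hw
    rw [← hβC]
    simp only [hN.apply_smul_add he₂ hw]
    exact sum_sq_mul_tripleVal hF (hN.eq_zero_or w)
  have k1 := key _ (add_mem he₁ hw)
  have k2 := key _ he₁
  have k3 := key _ hw
  obtain ⟨⟨h1, -⟩, ⟨h2, -⟩, ⟨h3, -⟩, ⟨h4, -⟩, -⟩ := hN
  simp only [map_add, LinearMap.add_apply, h1, h3, h4, hβ w e₁] at k1 k2 k3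
  linear_combination k1 - k2 - k3

theorem NormalForm.moment_three (hF : 4 < Fintype.card F)
    (hN : NormalForm odd C H e₁ e₂ M₁ M₂ M₃ h) (ho : h = 0) (he₁ : e₁ ∈ H) (he₂ : e₂ ∈ H)
    {φ : V →ₗ[F] F} {k ω : F} (hφ : ∀ u,
      ∑ x : F, x ^ 3 * C (x • e₂ + (ω • e₁ + u)) - ω * ∑ x : F, x ^ 3 * C (x • e₂ + (e₁ + u)) -
        (1 - ω) * ∑ x : F, x ^ 3 * C (x • e₂ + u) = φ u + k) {w : V} (hw : w ∈ H) :
    φ w = 3 * C (e₁ + e₂) * (ω - ω ^ 2) * M₃ w := by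
  have key : ∀ w ∈ H, ∑ x : F, x ^ 3 * C (x • e₂ + w) =
      -(C e₁ * M₁ w ^ 3 + C (e₁ + e₂) * M₃ w ^ 3) := by
    intro w hw
    simp only [hN.apply_smul_add he₂ hw, ho, LinearMap.zero_apply]
    exact sum_cube_mul_tripleVal hF
  obtain ⟨⟨h1, -⟩, ⟨h2, -⟩, ⟨h3, -⟩, ⟨h4, -⟩, -⟩ := hN
  have k : ∀ u ∈ H, φ u + k = C (e₁ + e₂) * (3 * (ω - ω ^ 2) * M₃ u + ω ^ 3 - ω) := by
    intro u hu
    rw [← hφ, key _ (add_mem (H.smul_mem ω he₁) hu), key _ (add_mem he₁ hu), key _ hu]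
    simp only [map_add, map_smul, h1, h3, smul_eq_mul]
    ring
  have k0 := k 0 (zero_mem H)
  have k1 := k w hw
  rw [map_zero, map_zero] at k0
  linear_combination k1 - k0

theorem not_forall_normalForm {n : ℕ} (hn : 3 ≤ n) (hF : 4 < Fintype.card F)
    {C : (Fin (n + 1) → F) → F} (hC : C ∈ hypFun F (Fin (n + 1) → F)) {odd : Prop}
    (ho : odd → (2 : F) ≠ 0) {e₁ e₂ : Fin (n + 1) → F}
    (hl : Module.finrank F (Submodule.span F {e₁, e₂}) = 2) (h1 : C e₁ ≠ 0) (h2 : C e₂ ≠ 0)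
    (h3 : C (e₁ + e₂) ≠ 0) :
    ¬ ∀ H : Submodule F (Fin (n + 1) → F), Module.finrank F H = n → Submodule.span F {e₁, e₂} ≤ H →
      ∃ M₁ M₂ M₃ h, NormalForm odd C H e₁ e₂ M₁ M₂ M₃ h := by
  intro hall
  have hmem : ∀ {H : Submodule F (Fin (n + 1) → F)}, Submodule.span F {e₁, e₂} ≤ H →
      e₁ ∈ H ∧ e₂ ∈ H := fun hH =>
    ⟨hH (Submodule.subset_span (by simp)), hH (Submodule.subset_span (by simp))⟩
  have hker : ∀ ψ : (Fin (n + 1) → F) →ₗ[F] F, ψ e₁ = 0 → ψ e₂ = 0 →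
      ∃ H : Submodule F (Fin (n + 1) → F), Module.finrank F H = n ∧
        Submodule.span F {e₁, e₂} ≤ H ∧ H ≤ LinearMap.ker ψ := fun ψ z1 z2 =>
    exists_hyperplane hn hl (le_finrank_ker ψ) (Submodule.span_le.2 (by
      rintro v (rfl | rfl)
      · exact z1
      · exact z2))
  obtain ⟨H₀, hH₀, hlH₀, -⟩ := hker 0 rfl rfl
  obtain ⟨φ₁, hφ₁⟩ := hypFun_moment_one (by omega) hC e₂
  obtain ⟨φ₂, hφ₂⟩ := hypFun_moment_one (by omega) hC e₁
  obtain ⟨β₁, hβ₁, hβ₁C⟩ := hypFun_moment_two (by omega) hC e₂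
  obtain ⟨β₂, hβ₂, hβ₂C⟩ := hypFun_moment_two (by omega) hC e₁
  by_cases hodd : odd
  · have key : ∀ (H : Submodule F (Fin (n + 1) → F)) (M₁ M₂ M₃ h),
        Submodule.span F {e₁, e₂} ≤ H → NormalForm odd C H e₁ e₂ M₁ M₂ M₃ h →
        ∀ w ∈ H, h w = -(β₁ e₁ w + β₂ e₂ w) := by
      intro H M₁ M₂ M₃ h hlH hN w hw
      obtain ⟨m1, m2⟩ := hmem hlH
      have k1 := hN.moment_two (by omega) m1 m2 hβ₁ hβ₁C hw
      have k2 := hN.swap.moment_two (by omega) m2 m1 hβ₂ hβ₂C hw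
      rw [LinearMap.neg_apply, add_comm e₂ e₁] at k2
      exact mul_left_cancel₀ (ho hodd) (by linear_combination k1 + k2)
    have hz : ∀ v ∈ ({e₁, e₂} : Set (Fin (n + 1) → F)), (β₁ e₁ + β₂ e₂) v = 0 := by
      intro v hv
      obtain ⟨M₁, M₂, M₃, h, hN⟩ := hall H₀ hH₀ hlH₀
      have := key _ _ _ _ _ hlH₀ hN v (hlH₀ (Submodule.subset_span hv))
      have hv0 : h v = 0 := by
        rcases hv with rfl | rfl
        · exact hN.2.2.2.1.1
        · exact hN.2.2.2.1.2
      rw [LinearMap.add_apply]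
      linear_combination this - hv0
    obtain ⟨H, hH, hlH, hHψ⟩ := hker _ (hz e₁ (by simp)) (hz e₂ (by simp))
    obtain ⟨M₁, M₂, M₃, h, hN⟩ := hall H hH hlH
    have hN' := hN
    obtain ⟨-, -, -, -, -, ⟨hn, -⟩ | ⟨-, -, w, hw, hw0⟩⟩ := hN'
    · exact hn hodd
    · have := LinearMap.mem_ker.1 (hHψ hw)
      rw [LinearMap.add_apply] at this
      exact hw0 (by rw [key _ _ _ _ _ hlH hN w hw, this, neg_zero])
  · have hh0 : ∀ {H : Submodule F (Fin (n + 1) → F)} {M₁ M₂ M₃ h},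
        NormalForm odd C H e₁ e₂ M₁ M₂ M₃ h → h = 0 := by
      rintro H M₁ M₂ M₃ h ⟨-, -, -, -, -, ⟨-, hh, -⟩ | ⟨hodd', -⟩⟩
      · exact hh
      · exact absurd hodd' hodd
    obtain ⟨ψ₃, hψ₃⟩ : ∃ ψ₃ : (Fin (n + 1) → F) →ₗ[F] F,
        ∀ (H : Submodule F (Fin (n + 1) → F)) (M₁ M₂ M₃ h),
        Submodule.span F {e₁, e₂} ≤ H → NormalForm odd C H e₁ e₂ M₁ M₂ M₃ h →
        ∀ w ∈ H, M₃ w = ψ₃ w := by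
      by_cases h2F : (2 : F) = 0
      · obtain ⟨ω, hω⟩ : ∃ ω : F, ω ∉ ({0, 1} : Finset F) := by
          by_contra! hcon
          have := Finset.card_le_card (fun x _ => hcon x : (Finset.univ : Finset F) ⊆ _)
          have h5 := Finset.card_le_two (a := (0 : F)) (b := 1)
          rw [Finset.card_univ] at this
          omega
        simp only [Finset.mem_insert, Finset.mem_singleton, not_or] at hω
        obtain ⟨φ, k, hφ⟩ := hypFun_moment_three hF hC e₂ e₁ ω
        have hne : 3 * C (e₁ + e₂) * (ω - ω ^ 2) ≠ 0 := by
          rw [show (3 : F) = 1 by linear_combination h2F, one_mul,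
            show ω - ω ^ 2 = ω * (1 - ω) by ring]
          exact mul_ne_zero h3 (mul_ne_zero hω.1 (sub_ne_zero.2 (Ne.symm hω.2)))
        refine ⟨(3 * C (e₁ + e₂) * (ω - ω ^ 2))⁻¹ • φ, fun H M₁ M₂ M₃ h hlH hN w hw => ?_⟩
        rw [LinearMap.smul_apply, smul_eq_mul, eq_inv_mul_iff_mul_eq₀ hne]
        exact (hN.moment_three hF (hh0 hN) (hmem hlH).1 (hmem hlH).2 hφ hw).symm
      · refine ⟨-((C (e₁ + e₂))⁻¹ • β₁ e₁), fun H M₁ M₂ M₃ h hlH hN w hw => ?_⟩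
        have k := hN.moment_two (by omega) (hmem hlH).1 (hmem hlH).2 hβ₁ hβ₁C hw
        rw [hh0 hN, LinearMap.zero_apply] at k
        rw [LinearMap.neg_apply, LinearMap.smul_apply, smul_eq_mul, ← mul_neg,
          eq_inv_mul_iff_mul_eq₀ h3]
        exact mul_left_cancel₀ h2F (by linear_combination k)
    let ψ : (Fin (n + 1) → F) →ₗ[F] F := -((C e₁)⁻¹ • (φ₁ + C (e₁ + e₂) • ψ₃)) +
      (C e₂)⁻¹ • (φ₂ - C (e₁ + e₂) • ψ₃) - ψ₃
    have key : ∀ (H : Submodule F (Fin (n + 1) → F)) (M₁ M₂ M₃ h),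
        Submodule.span F {e₁, e₂} ≤ H → NormalForm odd C H e₁ e₂ M₁ M₂ M₃ h →
        ∀ w ∈ H, M₁ w - M₂ w - M₃ w = ψ w := by
      intro H M₁ M₂ M₃ h hlH hN w hw
      have k1 := hN.moment_one (by omega) (hmem hlH).2 hφ₁ hw
      have k2 := hN.swap.moment_one (by omega) (hmem hlH).1 hφ₂ hw
      have k3 := hψ₃ H _ _ _ _ hlH hN w hw
      rw [LinearMap.neg_apply, add_comm e₂ e₁] at k2
      rw [hh0 hN, LinearMap.zero_apply] at k1 k2
      simp only [ψ, LinearMap.add_apply, LinearMap.sub_apply, LinearMap.neg_apply,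
        LinearMap.smul_apply, smul_eq_mul, k1, k2, ← k3]
      field_simp
      ring
    have hz : ψ e₁ = 0 ∧ ψ e₂ = 0 := by
      obtain ⟨M₁, M₂, M₃, h, hN⟩ := hall H₀ hH₀ hlH₀
      rw [← key _ _ _ _ _ hlH₀ hN _ (hmem hlH₀).1, ← key _ _ _ _ _ hlH₀ hN _ (hmem hlH₀).2]
      obtain ⟨⟨h1, h1'⟩, ⟨h2, h2'⟩, ⟨h3, h3'⟩, -⟩ := hN
      simp [h1, h1', h2, h2', h3, h3']
    obtain ⟨H, hH, hlH, hHψ⟩ := hker _ hz.1 hz.2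
    obtain ⟨M₁, M₂, M₃, h, hN⟩ := hall H hH hlH
    have hN' := hN
    obtain ⟨-, -, -, -, -, ⟨-, -, w, hw, hw0⟩ | ⟨hodd', -⟩⟩ := hN'
    · refine hw0 ?_
      have := key _ _ _ _ _ hlH hN w hw
      rw [LinearMap.mem_ker.1 (hHψ hw)] at this
      linear_combination this
    · exact hodd hodd'

end LargeField

section Secant

/-- A `3`-secant is spanned by two points of the support whose sum is the third one. -/
theorem secant.exists_frame {p n : ℕ} [Fact p.Prime] {ι : ZMod p →+* F} {c : Pt F n → ZMod p}
    {C : (Fin (n + 1) → F) → F} (hC : C ∈ hypFun F (Fin (n + 1) → F))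
    (hCc : ∀ v (hv : v ≠ 0), C v = ι (c (Projectivization.mk F v hv)))
    {l : Submodule F (Fin (n + 1) → F)} (hl : secant c l 3) :
    ∃ e₁ e₂, Submodule.span F {e₁, e₂} = l ∧ C e₁ ≠ 0 ∧ C e₂ ≠ 0 ∧ C (e₁ + e₂) ≠ 0 ∧
      ∀ x : F, x ≠ 0 → x ≠ 1 → C (e₁ + x • e₂) = 0 := by
  obtain ⟨hl2, hl3⟩ := hl
  obtain ⟨P, Q, R, hPQ, hPR, hQR, hS⟩ := Set.ncard_eq_three.1 hl3
  have hmem : ∀ v (hv : v ≠ 0), v ∈ l → C v ≠ 0 →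
      Projectivization.mk F v hv ∈ ({P, Q, R} : Set (Pt F n)) := by
    intro v hv hvl hCv
    rw [← hS]
    refine ⟨(ptIn_mk hv l).2 hvl, fun h => hCv ?_⟩
    rw [hCc v hv, h, map_zero]
  have hrep : ∀ T ∈ ({P, Q, R} : Set (Pt F n)), T.rep ∈ l ∧ C T.rep ≠ 0 := by
    intro T hT
    rw [← hS] at hT
    rw [← T.mk_rep] at hT
    refine ⟨(ptIn_mk T.rep_nonzero l).1 hT.1, ?_⟩
    rw [hCc _ T.rep_nonzero]
    exact (map_ne_zero ι).2 hT.2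
  obtain ⟨hP, hCP⟩ := hrep P (by simp)
  obtain ⟨hQ, hCQ⟩ := hrep Q (by simp)
  obtain ⟨hR, hCR⟩ := hrep R (by simp)
  have hne : ∀ {S T : Pt F n}, S ≠ T → ∀ a : F, T.rep ≠ a • S.rep := by
    intro S T hST a h
    refine hST ?_
    rw [← S.mk_rep, ← T.mk_rep, Projectivization.mk_eq_mk_iff']
    have ha : a ≠ 0 := fun ha => T.rep_nonzero (by rw [h, ha, zero_smul])
    exact ⟨a⁻¹, by rw [h, inv_smul_smul₀ ha]⟩
  have hind : LinearIndependent F ![P.rep, Q.rep] :=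
    (LinearIndependent.pair_iff' P.rep_nonzero).2 fun a h => hne hPQ a h.symm
  have hspan : Submodule.span F {P.rep, Q.rep} = l := by
    refine Submodule.eq_of_le_of_finrank_eq (Submodule.span_le.2 ?_) ?_
    · rintro v (rfl | rfl) <;> assumption
    · have := finrank_span_eq_card hind
      rw [Matrix.range_cons, Matrix.range_cons, Matrix.range_empty, Set.union_empty,
        Set.singleton_union, Fintype.card_fin] at this
      rw [this, hl2]
  rw [← hspan] at hR
  obtain ⟨a, b, hab⟩ := Submodule.mem_span_pair.1 hR
  have ha : a ≠ 0 := fun ha => hne hQR b (by rw [← hab, ha, zero_smul, zero_add])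
  have hb : b ≠ 0 := fun hb => hne hPR a (by rw [← hab, hb, zero_smul, add_zero])
  refine ⟨a • P.rep, b • Q.rep, ?_, ?_, ?_, by rwa [hab], fun x hx0 hx1 => ?_⟩
  · refine le_antisymm (Submodule.span_le.2 ?_) ?_
    · rintro v (rfl | rfl)
      · exact l.smul_mem _ hP
      · exact l.smul_mem _ hQ
    · rw [← hspan, Submodule.span_le]
      rintro v (rfl | rfl)
      · exact (Submodule.smul_mem_iff _ ha).1 (Submodule.subset_span (by simp))
      · exact (Submodule.smul_mem_iff _ hb).1 (Submodule.subset_span (by simp))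
  · rwa [hypFun_smul hC ha]
  · rwa [hypFun_smul hC hb]
  · have hlin : ∀ s t : F, s • P.rep + t • Q.rep = 0 → s = 0 ∧ t = 0 :=
      LinearIndependent.pair_iff.1 hind
    have hv : a • P.rep + x • b • Q.rep ≠ 0 := fun h => ha (hlin a (x * b) (by rwa [mul_smul])).1
    by_contra hCv
    have hy : ∀ {T : Pt F n}, Projectivization.mk F _ hv = T →
        ∃ y : F, y • (a • P.rep + x • b • Q.rep) = T.rep := fun {T} h => by
      rw [← T.mk_rep] at h
      exact Projectivization.mk_eq_mk_iff' F _ _ T.rep_nonzero hv |>.1 h.symm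
    obtain h | h | h := hmem _ hv (l.add_mem (l.smul_mem _ hP)
      (l.smul_mem _ (l.smul_mem _ hQ))) hCv
    · obtain ⟨y, hy⟩ := hy h
      obtain ⟨k1, k2⟩ := hlin (y * a - 1) (y * x * b) (by
        linear_combination (norm := module) hy)
      have hy0 : y = 0 := by simpa [hx0, hb] using k2
      simp [hy0] at k1
    · obtain ⟨y, hy⟩ := hy h
      obtain ⟨k1, k2⟩ := hlin (y * a) (y * x * b - 1) (by
        linear_combination (norm := module) hy)
      have hy0 : y = 0 := by simpa [ha] using k1
      simp [hy0] at k2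
    · obtain ⟨y, hy⟩ := hy h
      rw [← hab] at hy
      obtain ⟨k1, k2⟩ := hlin (y * a - a) (y * x * b - b) (by
        linear_combination (norm := module) hy)
      obtain rfl : y = 1 := mul_right_cancel₀ ha (by linear_combination k1)
      exact hx1 (mul_right_cancel₀ hb (by linear_combination k2))

end Secant

section SmallField

variable {p q n : ℕ} [Fact p.Prime] [Fintype F]

theorem not_forall_spaceIsType_of_card_eq_two (hn : 3 ≤ n) (hF : Fintype.card F = 2)
    {ι : ZMod p →+* F} {c : Pt F n → ZMod p} {C : (Fin (n + 1) → F) → F}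
    (hC : C ∈ hypFun F (Fin (n + 1) → F))
    (hCc : ∀ v (hv : v ≠ 0), C v = ι (c (Projectivization.mk F v hv)))
    {e₁ e₂ : Fin (n + 1) → F} (hl : Module.finrank F (Submodule.span F {e₁, e₂}) = 2)
    (h1 : C e₁ ≠ 0) (h2 : C e₂ ≠ 0) (h3 : C (e₁ + e₂) ≠ 0) {t : PlaneT}
    (ht : t = PlaneT.Todd ∨ t = PlaneT.Ttri) :
    ¬ ∀ H : Submodule F (Fin (n + 1) → F), Module.finrank F H = n → Submodule.span F {e₁, e₂} ≤ H →
      SpaceIsType p q c H (n - 1) t := by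
  intro hall
  have hone : ∀ {x : F}, x ≠ 0 → x = 1 := fun {x} hx => by
    have := FiniteField.pow_card_sub_one_eq_one x hx
    rwa [hF, pow_one] at this
  have htwo : (1 : F) + 1 = 0 := by
    have := Nat.cast_card_eq_zero F
    rw [hF] at this
    linear_combination this
  obtain ⟨φ, hφ⟩ := hypFun_affine hF hC
  have k1 := hone h1
  have k2 := hone h2
  have k3 := hone h3
  rw [hφ] at k1 k2 k3
  rw [map_add] at k3
  have hφ1 : φ e₁ = 0 := by linear_combination k2 - k3
  have hφ2 : φ e₂ = 0 := by linear_combination k1 - k3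
  obtain ⟨H, hH, hlH, hHφ⟩ := exists_hyperplane hn hl (le_finrank_ker φ) (Submodule.span_le.2 (by
    rintro v (rfl | rfl)
    · exact hφ1
    · exact hφ2))
  have hCH : ∀ v ∈ H, C v = 1 := fun v hv => by
    rw [hφ, LinearMap.mem_ker.1 (hHφ hv)]
    linear_combination k1 + hφ1
  obtain ⟨W, hW, hWH, hWt, -⟩ := (hall H hH hlH).exists_proj hn hC hCc
  rcases ht with rfl | rfl
  · obtain ⟨X₀, X₁, X₂, γ, a, b, d, hγ, -, ⟨w₁, hw₁, p₀, p₁, p₂⟩, ⟨w₂, hw₂, q₀, q₁, q₂⟩, hX⟩ :=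
      TypeOdd.exists_form hC hCc hWt
    have hne : ∀ z, X₁ z = 1 → z ≠ 0 := by rintro z hz rfl; simp at hz
    have m1 := hX w₁ hw₁ (Or.inl (hne _ p₁))
    have m2 := hX (w₁ + w₂) (add_mem hw₁ hw₂) (Or.inl (hne _ (by simp [p₁, q₁])))
    rw [hCH _ (hWH hw₁)] at m1
    rw [hCH _ (hWH (add_mem hw₁ hw₂))] at m2
    simp only [map_add, p₀, p₁, p₂, q₀, q₁, q₂, add_zero, zero_add, one_ne_zero, if_true, if_false,
      zero_ne_one, mul_zero, zero_div, div_one, mul_one] at m1 m2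
    exact hγ ((map_eq_zero ι).1 (by linear_combination m1 - m2))
  · obtain ⟨L₁, L₂, L₃, a₁, a₂, a₃, ha₁, ha₂, -, -, -, ⟨w₃, hw₃, r₁, r₂, r₃⟩, hL⟩ :=
      TypeTri.exists_form hC hCc hW hWt
    have m := hL w₃ hw₃
    rw [hCH _ (hWH hw₃)] at m
    simp only [r₁, r₂, r₃, one_ne_zero, if_true, if_false, hone ((map_ne_zero ι).2 ha₁),
      hone ((map_ne_zero ι).2 ha₂), htwo, add_zero] at m

/-- A quadratic polynomial in two variables over the field of order `3` whose quadratic part is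
a multiple of the sum of squares has at most `4` zeros. -/
theorem card_quadratic_zeros_le (hF : Fintype.card F = 3) {ε : F} (hε : ε ≠ 0) (b₁ b₂ k : F) :
    (Finset.univ.filter fun z : F × F =>
      k - (ε * z.1 ^ 2 + ε * z.2 ^ 2 + b₁ * z.1 + b₂ * z.2) = 0).card ≤ 4 := by
  have key : ∀ ε b₁ b₂ k : ZMod 3, ε ≠ 0 → (Finset.univ.filter fun z : ZMod 3 × ZMod 3 =>
      k - (ε * z.1 ^ 2 + ε * z.2 ^ 2 + b₁ * z.1 + b₂ * z.2) = 0).card ≤ 4 := by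
    decide
  let e : ZMod 3 ≃+* F := ZMod.ringEquivOfPrime F Nat.prime_three hF
  refine le_trans (le_of_eq ?_) (key (e.symm ε) (e.symm b₁) (e.symm b₂) (e.symm k) (by simpa))
  refine Finset.card_equiv (e.symm.toEquiv.prodCongr e.symm.toEquiv) fun z => ?_
  simp only [Finset.mem_filter, Finset.mem_univ, true_and, Equiv.prodCongr_apply, Prod.map,
    RingEquiv.toEquiv_eq_coe, EquivLike.coe_coe, ← map_pow, ← map_mul, ← map_add, ← map_sub,
    EmbeddingLike.map_eq_zero_iff]

/-- A quadratic form over the field of order `3` takes each value at most `4 * 3 ^ (n - 1)` times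
if it has an orthogonal pair of nonisotropic vectors of equal norm. -/
theorem card_zeros_le (hF : Fintype.card F = 3) {C : (Fin (n + 1) → F) → F} (hn : 1 ≤ n)
    {β : (Fin (n + 1) → F) →ₗ[F] (Fin (n + 1) → F) →ₗ[F] F} (hβ : ∀ v w, β v w = β w v)
    (hCβ : ∀ v, C v = C 0 - β v v) {e₁ e₂ : Fin (n + 1) → F} (h1 : β e₁ e₁ ≠ 0)
    (h2 : β e₂ e₂ = β e₁ e₁) (h12 : β e₁ e₂ = 0) :
    (Finset.univ.filter fun v => C v = 0).card ≤ 4 * 3 ^ (n - 1) := by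
  have hline : ∀ v, ∑ z : F × F, (if C (v + (z.1 • e₁ + z.2 • e₂)) = 0 then 1 else 0) ≤ 4 := by
    intro v
    rw [← Finset.card_filter]
    refine le_trans (le_of_eq (congrArg Finset.card (Finset.filter_congr fun z _ => ?_)))
      (card_quadratic_zeros_le hF h1 (2 * β v e₁) (2 * β v e₂) (C 0 - β v v))
    rw [hCβ]
    simp only [map_add, map_smul, LinearMap.add_apply, LinearMap.smul_apply, smul_eq_mul, h2, h12,
      hβ e₂ e₁, hβ e₁ v, hβ e₂ v]
    ring_nf
  have hsum : ∑ v : Fin (n + 1) → F, ∑ z : F × F,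
      (if C (v + (z.1 • e₁ + z.2 • e₂)) = 0 then 1 else 0) =
      9 * (Finset.univ.filter fun v => C v = 0).card := by
    rw [Finset.sum_comm]
    have : ∀ z : F × F, ∑ v : Fin (n + 1) → F,
        (if C (v + (z.1 • e₁ + z.2 • e₂)) = 0 then 1 else 0) =
        (Finset.univ.filter fun v => C v = 0).card := fun z => by
      rw [Finset.card_filter]
      exact Equiv.sum_comp (Equiv.addRight (z.1 • e₁ + z.2 • e₂)) fun v => if C v = 0 then 1 else 0
    simp only [this, Finset.sum_const, Finset.card_univ, Fintype.card_prod, hF, smul_eq_mul]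
  have hle := Finset.sum_le_sum fun v (_ : v ∈ Finset.univ) => hline v
  rw [hsum, Finset.sum_const, Finset.card_univ, Fintype.card_fun, hF, Fintype.card_fin,
    smul_eq_mul] at hle
  obtain ⟨m, rfl⟩ := Nat.exists_eq_add_of_le' hn
  rw [Nat.add_sub_cancel]
  rw [pow_succ, pow_succ] at hle
  omega

theorem card_le_wt (hF : Fintype.card F = 3) {ι : ZMod p →+* F} {c : Pt F n → ZMod p}
    {C : (Fin (n + 1) → F) → F} (hCc : ∀ v (hv : v ≠ 0), C v = ι (c (Projectivization.mk F v hv))) :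
    3 ^ (n + 1) ≤ (Finset.univ.filter fun v => C v = 0).card + 2 * wt c + 1 := by
  let S : Finset {v : Fin (n + 1) → F // v ≠ 0} := Finset.univ.filter fun v => C v ≠ 0
  have hS : S.card ≤ 2 * (S.image (Projectivization.mk' F)).card := by
    refine Finset.card_le_mul_card_image S 2 fun P _ => ?_
    have hsub : (S.filter fun v => Projectivization.mk' F v = P).image Subtype.val ⊆
        (Finset.univ.erase (0 : F)).image fun a => a • P.rep := by
      intro v hv
      simp only [Finset.mem_image, Finset.mem_filter] at hv
      obtain ⟨⟨v, hv⟩, ⟨-, rfl⟩, rfl⟩ := hv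
      obtain ⟨a, ha⟩ := (Projectivization.mk_eq_mk_iff' F v _ hv
        (Projectivization.rep_nonzero _)).1 (Projectivization.mk_rep (Projectivization.mk F v hv)).symm
      refine Finset.mem_image.2 ⟨a, by simp; rintro rfl; exact hv (by simpa using ha.symm), ha⟩
    have := (Finset.card_le_card hsub).trans Finset.card_image_le
    rwa [Finset.card_image_of_injective _ Subtype.val_injective,
      Finset.card_erase_of_mem (Finset.mem_univ _), Finset.card_univ, hF] at this
  have hwt : (S.image (Projectivization.mk' F)).card ≤ wt c := by
    rw [wt, ← Set.ncard_coe_finset]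
    refine Set.ncard_le_ncard ?_ (Set.toFinite _)
    intro P hP
    simp only [Finset.coe_image, Set.mem_image] at hP
    obtain ⟨⟨v, hv⟩, hvS, rfl⟩ := hP
    intro h
    refine (Finset.mem_filter.1 hvS).2 ?_
    exact (hCc v hv).trans (by rw [show c (Projectivization.mk F v hv) = 0 from h, map_zero])
  have htot : 3 ^ (n + 1) ≤ (Finset.univ.filter fun v => C v = 0).card +
      ((S.image Subtype.val).card + 1) := by
    have : (Finset.univ : Finset (Fin (n + 1) → F)) ⊆
        (Finset.univ.filter fun v => C v = 0) ∪ insert 0 (S.image Subtype.val) := by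
      intro v _
      by_cases hv : v = 0
      · simp [hv]
      · by_cases hCv : C v = 0 <;> simp [S, hv, hCv]
    have := (Finset.card_le_card this).trans (Finset.card_union_le _ _)
    rw [Finset.card_univ, Fintype.card_fun, hF, Fintype.card_fin] at this
    exact this.trans (Nat.add_le_add_left (Finset.card_insert_le _ _) _)
  rw [Finset.card_image_of_injective _ Subtype.val_injective] at htot
  omega

/-- The values of a quadratic form over the field of order `3` without orthogonal pairs of
nonisotropic vectors of equal norm, on a suitable subspace containing a given isotropic line. -/
theorem exists_functional_of_no_pair (hF : Fintype.card F = 3) {V : Type*} [AddCommGroup V]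
    [Module F V] {β : V →ₗ[F] V →ₗ[F] F} (hβ : ∀ v w, β v w = β w v)
    (hE : ∀ v w, β v v ≠ 0 → β w w = β v v → β v w ≠ 0) {t : V} (ht : β t t ≠ 0) :
    ∃ ψ : V →ₗ[F] F, ψ t = 0 ∧ (∀ v, β t v = 0 → β v v = 0 → ψ v = 0) ∧
      ∀ v, ψ v = 0 → β t t * β v v = β t v ^ 2 := by
  have h3 : (3 : F) = 0 := by
    have := Nat.cast_card_eq_zero F
    rw [hF] at this
    exact_mod_cast this
  have hval : ∀ v, β t v = 0 → β v v = 0 ∨ β v v = -β t t := by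
    intro v hv
    have hsq : ∀ x : F, x ≠ 0 → x ^ 2 = 1 := fun x hx => by
      have := FiniteField.pow_card_sub_one_eq_one x hx
      rwa [hF] at this
    refine or_iff_not_imp_left.2 fun hv0 => ?_
    refine (sq_eq_sq_iff_eq_or_eq_neg.1 ((hsq _ hv0).trans (hsq _ ht).symm)).resolve_left
      fun h => hE t v ht h hv
  have hpm : ∀ x : F, (x = 0 ∨ x = -β t t) → (-x = 0 ∨ -x = -β t t) → x = 0 := by
    rintro x (h | h) (h' | h')
    · exact h
    · exact h
    · exact neg_eq_zero.1 h'
    · exact absurd (show β t t = 0 by linear_combination h3 * β t t - h - h') ht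
  have hlift : ∀ ψ : V →ₗ[F] F, ψ t = 0 → (∀ v, β t v = 0 → ψ v = 0 → β v v = 0) →
      ∀ v, ψ v = 0 → β t t * β v v = β t v ^ 2 := by
    intro ψ hψt hψ v hv
    have := hψ (β t t • v - β t v • t) (by simp; ring) (by simp [hv, hψt])
    simp only [map_sub, map_smul, LinearMap.sub_apply, LinearMap.smul_apply, smul_eq_mul,
      hβ v t] at this
    exact mul_left_cancel₀ ht (by linear_combination this)
  by_cases hu : ∃ u, β t u = 0 ∧ β u u = -β t t
  · obtain ⟨u, hut, huu⟩ := hu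
    refine ⟨β u, by rw [hβ, hut], fun v hv hv0 => ?_, hlift _ (by rw [hβ, hut]) fun v hv huv => ?_⟩
    · have k1 := hval (u + v) (by simp [hut, hv])
      have k2 := hval (u - v) (by simp [hut, hv])
      simp only [map_add, map_sub, LinearMap.add_apply, LinearMap.sub_apply, hβ v u, huu, hv0]
        at k1 k2
      have k : 2 * β u v = 0 := by
        rcases k1 with k1 | k1 <;> rcases k2 with k2 | k2
        · exact absurd (show β t t = 0 by linear_combination h3 * β t t + k1 + k2) ht
        · exact absurd (show β t t = 0 by linear_combination -k1 - k2) ht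
        · exact absurd (show β t t = 0 by linear_combination -k1 - k2) ht
        · linear_combination k1
      linear_combination h3 * β u v - k
    · refine (hval v hv).resolve_right fun h => ?_
      have k := hval (u + v) (by simp [hut, hv])
      simp only [map_add, LinearMap.add_apply, hβ v u, huv, huu, h] at k
      rcases k with k | k
      · exact ht (by linear_combination h3 * β t t + k)
      · exact ht (by linear_combination -k)
  · refine ⟨0, rfl, fun _ _ _ => rfl, hlift 0 rfl fun v hv _ => ?_⟩
    exact (hval v hv).resolve_right fun h => hu ⟨v, hv, h⟩

end SmallField

section OrderThree

variable {p q n : ℕ} [Fact p.Prime] [Fintype F]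

theorem not_forall_spaceIsType_of_card_eq_three (hn : 3 ≤ n) (hF : Fintype.card F = 3)
    {ι : ZMod p →+* F} {c : Pt F n → ZMod p} {C : (Fin (n + 1) → F) → F}
    (hC : C ∈ hypFun F (Fin (n + 1) → F))
    (hCc : ∀ v (hv : v ≠ 0), C v = ι (c (Projectivization.mk F v hv)))
    (hwt : wt c ≤ 2 * 3 ^ (n - 1))
    {e₁ e₂ : Fin (n + 1) → F} (hl : Module.finrank F (Submodule.span F {e₁, e₂}) = 2)
    (h1 : C e₁ ≠ 0) (h2 : C e₂ ≠ 0) (h3 : C (e₁ + e₂) ≠ 0) (h4 : C (e₁ - e₂) = 0) {t : PlaneT}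
    (ht : t = PlaneT.Todd ∨ t = PlaneT.Ttri) :
    ¬ ∀ H : Submodule F (Fin (n + 1) → F), Module.finrank F H = n → Submodule.span F {e₁, e₂} ≤ H →
      SpaceIsType p q c H (n - 1) t := by
  intro hall
  have h3F : (3 : F) = 0 := by
    have := Nat.cast_card_eq_zero F
    rw [hF] at this
    exact_mod_cast this
  have h2F : (2 : F) ≠ 0 := fun h => one_ne_zero (α := F) (by linear_combination h3F - h)
  have hsq : ∀ {x : F}, x ≠ 0 → x = 1 ∨ x = -1 := fun {x} hx => by
    have := FiniteField.pow_card_sub_one_eq_one x hx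
    rw [hF] at this
    exact sq_eq_sq_iff_eq_or_eq_neg.1 (this.trans (one_pow 2).symm)
  obtain ⟨β, hβ, hCβ⟩ := hypFun_quadratic hF hC
  have hE : ∀ v w, β v v ≠ 0 → β w w = β v v → β v w ≠ 0 := by
    intro v w hv hw hvw
    have k1 := card_zeros_le hF (by omega) hβ hCβ hv hw hvw
    have k2 := card_le_wt hF hCc
    obtain ⟨m, rfl⟩ : ∃ m, n = m + 2 := ⟨n - 2, by omega⟩
    have k3 : 0 < 3 ^ m := by positivity
    rw [show m + 2 - 1 = m + 1 by omega] at *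
    rw [pow_succ, pow_succ] at k2
    rw [pow_succ] at *
    omega
  have hQ : ∀ v, β v v = C 0 - C v := fun v => by rw [hCβ v]; ring
  have hB : ∀ v w, 2 * β v w = C 0 - C (v + w) - β v v - β w w := fun v w => by
    rw [hCβ (v + w)]
    simp only [map_add, LinearMap.add_apply, hβ w v]
    ring
  rcases ht with rfl | rfl
  · have hodd : ∀ H : Submodule F (Fin (n + 1) → F), Module.finrank F H = n →
        Submodule.span F {e₁, e₂} ≤ H → ∃ w₀ ∈ H, ∃ w₁ ∈ H, ∃ w₂ ∈ H, ∃ γ : F, γ ≠ 0 ∧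
          β w₂ w₂ = 0 ∧ 2 * β w₀ w₂ = -γ ∧ 2 * β w₁ w₂ = -γ ∧ β (w₀ - w₁) (w₀ - w₁) = C 0 := by
      intro H hH hlH
      obtain ⟨W, hW, hWH, hWt, -⟩ := (hall H hH hlH).exists_proj hn hC hCc
      obtain ⟨X₀, X₁, X₂, γ, a, b, d, hγ, ⟨w₀, hw₀, p₀, p₁, p₂⟩, ⟨w₁, hw₁, q₀, q₁, q₂⟩,
        ⟨w₂, hw₂, r₀, r₁, r₂⟩, hX⟩ := TypeOdd.exists_form hC hCc hWt
      replace hX : ∀ z ∈ W, C z = _ := fun z hz => hX z hz (Or.inr (by omega))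
      have hne : (1 : F) ≠ -1 := fun h => h2F (by linear_combination h)
      have f := hX 0 (zero_mem _)
      have f0 := hX _ hw₀
      have f1 := hX _ hw₁
      have f2 := hX _ hw₂
      have f02 := hX _ (add_mem hw₀ hw₂)
      have f12 := hX _ (add_mem hw₁ hw₂)
      have f01 := hX _ (sub_mem hw₀ hw₁)
      simp only [map_add, map_sub, map_zero, p₀, p₁, p₂, q₀, q₁, q₂, r₀, r₁, r₂, add_zero, zero_add,
        sub_zero, zero_sub, neg_eq_zero, one_ne_zero, zero_ne_one, if_true, if_false, mul_zero,
        mul_one, div_zero, div_one, hne] at f f0 f1 f2 f02 f12 f01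
      refine ⟨w₀, hWH hw₀, w₁, hWH hw₁, w₂, hWH hw₂, ι γ, (map_ne_zero ι).2 hγ, ?_, ?_, ?_, ?_⟩
      · rw [hQ, f, f2]; ring
      · rw [hB, hQ, hQ, f, f0, f2, f02]; ring
      · rw [hB, hQ, hQ, f, f1, f2, f12]; ring
      · rw [hQ, f01, sub_zero]
    by_cases hs : C 0 = 0
    · have hQ1 : β e₁ e₁ ≠ 0 := by rw [hQ, hs, zero_sub]; exact neg_ne_zero.2 h1
      have hQ2 : β e₂ e₂ ≠ 0 := by rw [hQ, hs, zero_sub]; exact neg_ne_zero.2 h2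
      have k1 := hB e₁ e₂
      have k2 := hCβ (e₁ - e₂)
      simp only [map_sub, LinearMap.sub_apply, h4, hβ e₂ e₁] at k2
      rw [hs, zero_sub] at k1
      have hQ12 : β e₂ e₂ = β e₁ e₁ := by
        by_contra hne
        refine h3 ?_
        have : β e₁ e₁ + β e₂ e₂ = 0 := by
          rcases hsq hQ1 with m1 | m1 <;> rcases hsq hQ2 with m2 | m2 <;> simp [m1, m2] at hne ⊢
        linear_combination k1 + k2 + hs - 2 * this
      have hβ12 : β e₁ e₂ = β e₁ e₁ := mul_left_cancel₀ h2F (by linear_combination hQ12 - k2 - hs)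
      obtain ⟨ψ, hψt, hψ0, hψ⟩ := exists_functional_of_no_pair hF hβ hE hQ1
      have hψ12 := hψ0 (e₁ - e₂) (by rw [map_sub, hβ12, sub_self])
        (by simp [hβ e₂ e₁, hQ12, hβ12])
      obtain ⟨H, hH, hlH, hHψ⟩ := exists_hyperplane hn hl (le_finrank_ker ψ)
        (Submodule.span_le.2 (by
          rintro v (rfl | rfl)
          · exact hψt
          · rw [map_sub, hψt] at hψ12
            exact neg_eq_zero.1 (by linear_combination hψ12)))
      obtain ⟨-, -, w₁, hw₁, w₂, hw₂, γ, hγ, g2, -, g12, -⟩ := hodd H hH hlH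
      have m1 := hψ w₁ (hHψ hw₁)
      have m2 := hψ w₂ (hHψ hw₂)
      have m12 := hψ (w₁ + w₂) (hHψ (add_mem hw₁ hw₂))
      rw [g2, mul_zero, eq_comm, sq_eq_zero_iff] at m2
      simp only [map_add, LinearMap.add_apply, hβ w₂ w₁, g2, m2] at m12
      have : β e₁ e₁ * (2 * β w₁ w₂) = 0 := by linear_combination m12 - m1
      rw [g12] at this
      exact (mul_ne_zero hQ1 (neg_ne_zero.2 hγ)) this
    · obtain ⟨H, hH, hlH, -⟩ := exists_hyperplane hn hl (le_finrank_ker 0) (by simp)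
      obtain ⟨w₀, -, w₁, -, w₂, -, γ, hγ, g2, g02, g12, g01⟩ := hodd H hH hlH
      have hu : β (w₀ - w₁) w₂ = 0 := (mul_eq_zero.1 (show 2 * β (w₀ - w₁) w₂ = 0 by
        rw [map_sub, LinearMap.sub_apply]; linear_combination g02 - g12)).resolve_left h2F
      generalize hu' : w₀ - w₁ = u at hu g01
      let a : Fin (n + 1) → F := C 0 • (w₀ + w₁) - β u (w₀ + w₁) • u
      have ha : β u a = 0 := by simp only [a, map_sub, map_smul, smul_eq_mul, g01]; ring
      have haw : β a w₂ = -(C 0 * γ) := by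
        simp only [a, map_sub, map_add, map_smul, LinearMap.sub_apply, LinearMap.add_apply,
          LinearMap.smul_apply, smul_eq_mul, hu]
        refine mul_left_cancel₀ h2F ?_
        linear_combination C 0 * g02 + C 0 * g12
      refine hE u (a + ((C 0 - β a a) / (-2 * (C 0 * γ))) • w₂) (by rwa [g01]) ?_ ?_
      · rw [g01]
        simp only [map_add, map_smul, LinearMap.add_apply, LinearMap.smul_apply, smul_eq_mul,
          hβ w₂ a, haw, g2]
        field_simp
        ring
      · simp [ha, hu]
  · obtain ⟨H, hH, hlH, -⟩ := exists_hyperplane hn hl (le_finrank_ker 0) (by simp)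
    obtain ⟨W, hW, hWH, hWt, -⟩ := (hall H hH hlH).exists_proj hn hC hCc
    obtain ⟨L₁, L₂, L₃, a₁, a₂, a₃, ha₁, ha₂, ha₃, ⟨w₁, hw₁, p₁, p₂, p₃⟩, ⟨w₂, hw₂, q₁, q₂, q₃⟩,
      ⟨w₃, hw₃, r₁, r₂, r₃⟩, hL⟩ := TypeTri.exists_form hC hCc hW hWt
    have f0 := hL 0 (zero_mem _)
    have f1 := hL _ hw₁
    have f2 := hL _ hw₂
    have f3 := hL _ hw₃
    have f12 := hL _ (add_mem hw₁ hw₂)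
    have f13 := hL _ (add_mem hw₁ hw₃)
    have f23 := hL _ (add_mem hw₂ hw₃)
    simp only [map_add, map_zero, p₁, p₂, p₃, q₁, q₂, q₃, r₁, r₂, r₃, add_zero, zero_add,
      one_ne_zero, if_true, if_false] at f0 f1 f2 f3 f12 f13 f23
    have g1 : β w₁ w₁ = ι a₁ := by rw [hQ, f0, f1]; ring
    have g2 : β w₂ w₂ = ι a₂ := by rw [hQ, f0, f2]; ring
    have g3 : β w₃ w₃ = ι a₃ := by rw [hQ, f0, f3]; ring
    have g12 : β w₁ w₂ = 0 := by
      refine (mul_eq_zero.1 ?_).resolve_left h2F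
      rw [hB, f0, f12, g1, g2]; ring
    have g13 : β w₁ w₃ = 0 := by
      refine (mul_eq_zero.1 ?_).resolve_left h2F
      rw [hB, f0, f13, g1, g3]; ring
    have g23 : β w₂ w₃ = 0 := by
      refine (mul_eq_zero.1 ?_).resolve_left h2F
      rw [hB, f0, f23, g2, g3]; ring
    have b1 := (map_ne_zero ι).2 ha₁
    have b2 := (map_ne_zero ι).2 ha₂
    have b3 := (map_ne_zero ι).2 ha₃
    have n12 : ι a₂ ≠ ι a₁ := fun h => hE w₁ w₂ (by rwa [g1]) (by rw [g1, g2, h]) g12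
    have n13 : ι a₃ ≠ ι a₁ := fun h => hE w₁ w₃ (by rwa [g1]) (by rw [g1, g3, h]) g13
    have n23 : ι a₃ ≠ ι a₂ := fun h => hE w₂ w₃ (by rwa [g2]) (by rw [g2, g3, h]) g23
    rcases hsq b1 with k1 | k1 <;> rcases hsq b2 with k2 | k2 <;> rcases hsq b3 with k3 | k3 <;>
      simp [k1, k2, k3] at n12 n13 n23

end OrderThree

section Main

variable [Fintype F] {p q n : ℕ} [Fact p.Prime]

theorem not_forall_spaceIsType_of_seven_le (hn : 3 ≤ n) (hF : 7 ≤ Fintype.card F)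
    {ι : ZMod p →+* F} {c : Pt F n → ZMod p} {C : (Fin (n + 1) → F) → F}
    (hC : C ∈ hypFun F (Fin (n + 1) → F))
    (hCc : ∀ v (hv : v ≠ 0), C v = ι (c (Projectivization.mk F v hv)))
    {e₁ e₂ : Fin (n + 1) → F} (hl : Module.finrank F (Submodule.span F {e₁, e₂}) = 2)
    (h1 : C e₁ ≠ 0) (h2 : C e₂ ≠ 0) (h3 : C (e₁ + e₂) ≠ 0)
    (h0 : ∀ x : F, x ≠ 0 → x ≠ 1 → C (e₁ + x • e₂) = 0) {t : PlaneT}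
    (ht : t = PlaneT.Todd ∨ t = PlaneT.Ttri) :
    ¬ ∀ H : Submodule F (Fin (n + 1) → F), Module.finrank F H = n → Submodule.span F {e₁, e₂} ≤ H →
      SpaceIsType p q c H (n - 1) t := by
  intro hall
  have hF6 : ∀ s : Finset F, s.card ≤ 6 → ∃ x, x ∉ s := by
    intro s hs
    by_contra! hcon
    have := Finset.card_le_card (fun x _ => hcon x : (Finset.univ : Finset F) ⊆ s)
    rw [Finset.card_univ] at this
    omega
  refine not_forall_normalForm hn (by omega) hC (odd := t = PlaneT.Todd) ?_ hl h1 h2 h3 ?_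
  · rintro rfl h2F
    obtain ⟨H, hH, hlH, -⟩ := exists_hyperplane hn hl (le_finrank_ker 0) (by simp)
    obtain ⟨W, -, -, hWt, -⟩ := (hall H hH hlH).exists_proj hn hC hCc
    have hp : Fintype.card F = p := hWt.1
    have h2p : ((2 : ℕ) : ZMod p) = 0 := (map_eq_zero ι).1 (by
      rw [map_natCast]
      exact_mod_cast h2F)
    have := Nat.le_of_dvd two_pos ((ZMod.natCast_eq_zero_iff 2 p).1 h2p)
    omega
  · intro H hH hlH
    obtain ⟨N₁, N₂, N₃, h, a₁, a₂, a₃, hL⟩ :=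
      (hall H hH hlH).exists_localForm hn (by omega) hC hCc ht
    exact hL.exists_normalForm_of_secant hF6 (hlH (Submodule.subset_span (by simp)))
      (hlH (Submodule.subset_span (by simp))) h1 h2 h3 h0

theorem two_mul_pow_lt {q n : ℕ} (hq : 4 ≤ q) (hn : 3 ≤ n) :
    2 * q ^ (n - 1) < (3 * q - 6) * theta q ((n : ℤ) - 2) + 3 := by
  have hθ : theta q ((n : ℤ) - 2) * (q - 1) = q ^ (n - 1) - 1 := by
    rw [theta, if_neg (by omega), show ((n : ℤ) - 2).toNat + 1 = n - 1 by omega]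
    exact geom_sum_mul_of_one_le (by omega) _
  have : 2 * (q - 1) ≤ 3 * q - 6 := by omega
  have h1 : 1 ≤ q ^ (n - 1) := Nat.one_le_pow _ _ (by omega)
  have := Nat.mul_le_mul_right (theta q ((n : ℤ) - 2)) this
  rw [mul_assoc, mul_comm (q - 1), hθ] at this
  omega

end Main

/-- Lemma 26 of the paper: for a code word of weight between
`(3q-6)θ_{n-2}+3` and `B_{n,q}`, no `3`-secant lies in `θ_{n-2}` hyperplanes (i.e. all
hyperplanes through it) of one same type `T ∈ {T^odd, T^△}`. -/
theorem statement15 [Fintype F] {p h q n : ℕ} [Fact p.Prime] (hh : 1 ≤ h) (hq : q = p ^ h)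
    (hF : Fintype.card F = q) (hn : 3 ≤ n)
    (c : Pt F n → ZMod p) (hc : c ∈ code F p n)
    (hlow : (3 * q - 6) * theta q ((n : ℤ) - 2) + 3 ≤ wt c) (hwt : (wt c : ℝ) ≤ B n q) :
    ¬ ∃ (l : Submodule F (Fin (n + 1) → F)) (t : PlaneT), secant c l 3 ∧
        (t = PlaneT.Todd ∨ t = PlaneT.Ttri) ∧
        ∀ H : Submodule F (Fin (n + 1) → F), Module.finrank F H = n → l ≤ H →
          SpaceIsType p q c H (n - 1) t := by
  rintro ⟨l, t, hl, ht, hall⟩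
  have : CharP F p := charP_of_card_eq_prime_pow (hF.trans hq)
  let ι : ZMod p →+* F := ZMod.castHom dvd_rfl F
  obtain ⟨C, hC, hCc⟩ := exists_hypFun ι hc
  obtain ⟨e₁, e₂, rfl, h1, h2, h3, h0⟩ := hl.exists_frame hC hCc
  have hl2 : Module.finrank F (Submodule.span F {e₁, e₂}) = 2 := hl.1
  rcases le_or_gt 7 q with h7 | h7
  · exact not_forall_spaceIsType_of_seven_le hn (hF ▸ h7) hC hCc hl2 h1 h2 h3 h0 ht hall
  rw [B, if_pos (Or.inl h7)] at hwt
  replace hwt : wt c ≤ 2 * q ^ (n - 1) := by exact_mod_cast hwt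
  rcases le_or_gt 4 q with h4 | h4
  · have := two_mul_pow_lt h4 hn
    omega
  have hq1 : 1 < q := hF ▸ Fintype.one_lt_card
  obtain rfl | rfl : q = 2 ∨ q = 3 := by omega
  · exact not_forall_spaceIsType_of_card_eq_two hn hF hC hCc hl2 h1 h2 h3 ht hall
  · refine not_forall_spaceIsType_of_card_eq_three hn hF hC hCc hwt hl2 h1 h2 h3 ?_ ht hall
    rw [sub_eq_add_neg, ← neg_one_smul F e₂]
    refine h0 _ (by simp) fun h => ?_
    have h3F := Nat.cast_card_eq_zero F
    rw [hF] at h3F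
    push_cast at h3F
    exact one_ne_zero (α := F) (by linear_combination h3F + h)

end PGCode
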